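/- Let G₁, G₂ be hyperbolic groups with quasiconvex subgroups H₁, H₂ of infinite index, limit sets Λ₁, Λ₂, collections ℒᵢ of translates of Λᵢ by representatives of distinct cosets and 𝒥ᵢ the corresponding collections of joins. Let φ : 𝒥₁ → 𝒥₂ be a uniformly proper bijection and let q : Γ₁ → Γ₂ be a quasi-isometry pairing 𝒥₁ with 𝒥₂ as φ does, with boundary extension ∂q : ∂G₁ → ∂G₂. Then for any finitely many members L₁¹, …, L_k¹ of ℒ₁, the following are equivalent: (1) ⋂ᵢ Lᵢ¹ = ∅; (2) ⋂ᵢ ∂q(Lᵢ¹) = ∅; (3) ⋂ᵢ φ(Lᵢ¹) = ∅, where φ(Lᵢ¹) denotes the limit set of φ(J(Lᵢ¹)). -/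

import Mathlib

/-!
Common coarse-geometric definitions used to formalize statements from
"Relative Rigidity, Quasiconvexity and C-Complexes" (Mahan Mj).

We model the Cayley graph of a finitely generated group by the group itself
equipped with a word metric (the vertex set of the Cayley graph, with
bi-infinite geodesics modelled by `ℤ`-parametrized discrete geodesics), and we
set up all basic notions (Gromov products, hyperbolicity, the Gromov boundary
via Gromov sequences, limit sets, joins, quasiconvexity, electric metrics and
relative hyperbolicity à la Farb, uniformly proper maps, quasi-isometries)
relative to an abstract distance function `d : α → α → ℝ`.
-/

open Filter Set Metric
open scoped ENNReal

noncomputable section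

namespace RelRig

universe u v

variable {α β : Type*}

/-- Gromov product of `x`, `y` based at `w`. -/
def gpD (d : α → α → ℝ) (w x y : α) : ℝ := (d w x + d w y - d x y) / 2

/-- `d` satisfies the Gromov four-point condition with constant `δ`. -/
def DeltaHypD (d : α → α → ℝ) (δ : ℝ) : Prop :=
  ∀ w x y z : α, min (gpD d w x y) (gpD d w y z) - δ ≤ gpD d w x z

/-- `d` is Gromov-hyperbolic. -/
def HypD (d : α → α → ℝ) : Prop := ∃ δ ≥ (0 : ℝ), DeltaHypD d δ

/-- distance from a point to a set. -/
def pdistD (d : α → α → ℝ) (x : α) (A : Set α) : ℝ := sInf {r | ∃ a ∈ A, r = d x a}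

/-- (infimal) distance between two sets. -/
def setDistD (d : α → α → ℝ) (A B : Set α) : ℝ := sInf {r | ∃ a ∈ A, ∃ b ∈ B, r = d a b}

/-- closed `r`-neighbourhood of a set. -/
def nbdD (d : α → α → ℝ) (r : ℝ) (A : Set α) : Set α := {x | ∃ a ∈ A, d x a ≤ r}

/-- a sequence going to infinity (a "Gromov sequence"). -/
def GromovSeqD (d : α → α → ℝ) (w : α) (s : ℕ → α) : Prop :=
  Tendsto (fun p : ℕ × ℕ => gpD d w (s p.1) (s p.2)) atTop atTop

/-- asymptoticity of Gromov sequences. -/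
def bdryRelD (d : α → α → ℝ) (w : α) (s t : {u : ℕ → α // GromovSeqD d w u}) : Prop :=
  Tendsto (fun p : ℕ × ℕ => gpD d w (s.1 p.1) (t.1 p.2)) atTop atTop

/-- The Gromov boundary of `(α, d)`: asymptoticity classes of Gromov sequences. -/
def BdryD (d : α → α → ℝ) (w : α) := Quot (bdryRelD d w)

/-- `s` converges to the boundary point `ξ`. -/
def ConvTo (d : α → α → ℝ) (w : α) (s : ℕ → α) (ξ : BdryD d w) : Prop :=
  ∃ hs : GromovSeqD d w s, Quot.mk (bdryRelD d w) ⟨s, hs⟩ = ξ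

/-- the limit set of a subset `A ⊆ α` in the Gromov boundary. -/
def limitSetD (d : α → α → ℝ) (w : α) (A : Set α) : Set (BdryD d w) :=
  {ξ | ∃ s : ℕ → α, (∀ n, s n ∈ A) ∧ ConvTo d w s ξ}

/-- Gromov product of two boundary points. -/
def bgpD (d : α → α → ℝ) (w : α) (ξ η : BdryD d w) : ℝ≥0∞ :=
  ⨆ s : {s : ℕ → α // ConvTo d w s ξ}, ⨆ t : {t : ℕ → α // ConvTo d w t η},
    Filter.liminf (fun p : ℕ × ℕ => ENNReal.ofReal (gpD d w (s.1 p.1) (t.1 p.2))) atTop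

open Classical in
/-- the visual (quasi-)metric on the boundary. -/
def vdistD (d : α → α → ℝ) (w : α) (ξ η : BdryD d w) : ℝ :=
  if ξ = η then 0 else Real.exp (-(bgpD d w ξ η).toReal)

/-- visual diameter of a subset of the boundary. -/
def vdiamD (d : α → α → ℝ) (w : α) (Λ : Set (BdryD d w)) : ℝ :=
  sSup {r | ∃ ξ ∈ Λ, ∃ η ∈ Λ, r = vdistD d w ξ η}

/-- Hausdorff distance between two subsets of the boundary (visual metric). -/
def vHdistD (d : α → α → ℝ) (w : α) (A B : Set (BdryD d w)) : ℝ :=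
  max (sSup {r | ∃ a ∈ A, r = sInf {t | ∃ b ∈ B, t = vdistD d w a b}})
      (sSup {r | ∃ b ∈ B, r = sInf {t | ∃ a ∈ A, t = vdistD d w a b}})

/-- closed subsets of the boundary w.r.t. the visual metric. -/
def VClosed (d : α → α → ℝ) (w : α) (K : Set (BdryD d w)) : Prop :=
  ∀ ξ : BdryD d w, (∀ ε > (0 : ℝ), ∃ η ∈ K, vdistD d w ξ η < ε) → ξ ∈ K

/-- A family (multiset) of boundary subsets is a discrete subset of `C_c⁰(∂X)`,
the space of closed subsets of the boundary having more than one point, with the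
Hausdorff topology: the family does not accumulate (with multiplicity) at any
closed subset of the boundary having more than one point. -/
def DiscreteFamilyD {ι : Type*} (d : α → α → ℝ) (w : α) (L : ι → Set (BdryD d w)) : Prop :=
  ∀ K : Set (BdryD d w), VClosed d w K → K.Nontrivial →
    ¬ (∀ ε > (0 : ℝ), {i : ι | vHdistD d w (L i) K < ε}.Infinite)

/-- discrete geodesic of length `m` (suitable for graphs/word metrics). -/
def DiscGeodD (d : α → α → ℝ) (c : ℕ → α) (m : ℕ) : Prop :=
  ∀ i, i ≤ m → ∀ j, j ≤ m → d (c i) (c j) = |(i : ℝ) - (j : ℝ)|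

/-- discrete bi-infinite geodesic. -/
def DiscLineD (d : α → α → ℝ) (γ : ℤ → α) : Prop :=
  ∀ i j : ℤ, d (γ i) (γ j) = |(i : ℝ) - (j : ℝ)|

/-- `A` is a `K`-quasiconvex subset: every (discrete) geodesic with endpoints
in `A` stays in the `K`-neighbourhood of `A`. -/
def QCSetD (d : α → α → ℝ) (K : ℝ) (A : Set α) : Prop :=
  ∀ (c : ℕ → α) (m : ℕ), DiscGeodD d c m → c 0 ∈ A → c m ∈ A →
    ∀ i, i ≤ m → pdistD d (c i) A ≤ K

/-- both endpoints of the bi-infinite geodesic `γ` lie in `Λ`. -/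
def LineEndsInD (d : α → α → ℝ) (w : α) (γ : ℤ → α) (Λ : Set (BdryD d w)) : Prop :=
  (∃ ξ ∈ Λ, ConvTo d w (fun n : ℕ => γ (n : ℤ)) ξ) ∧
  (∃ η ∈ Λ, ConvTo d w (fun n : ℕ => γ (-(n : ℤ))) η)

/-- the join `J(Λ)`: the union of all bi-infinite geodesics with both endpoints in `Λ`. -/
def joinD (d : α → α → ℝ) (w : α) (Λ : Set (BdryD d w)) : Set α :=
  {p | ∃ γ : ℤ → α, DiscLineD d γ ∧ LineEndsInD d w γ Λ ∧ p ∈ Set.range γ}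

/-- a nearest-point projection onto `A`. -/
def IsNearestProjD (d : α → α → ℝ) (A : Set α) (P : α → α) : Prop :=
  ∀ x : α, P x ∈ A ∧ ∀ a ∈ A, d x (P x) ≤ d x a

/-- uniformly proper pairing of two collections of subsets (Schwarz, Mj). -/
def UProperD {ι κ : Type*} (d₁ : α → α → ℝ) (d₂ : β → β → ℝ)
    (J₁ : ι → Set α) (J₂ : κ → Set β) (φ : ι → κ) : Prop :=
  ∃ f : ℕ → ℕ, ∀ (n : ℕ) (i i' : ι),
    (setDistD d₁ (J₁ i) (J₁ i') ≤ (n : ℝ) →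
      setDistD d₂ (J₂ (φ i)) (J₂ (φ i')) ≤ (f n : ℝ)) ∧
    (setDistD d₂ (J₂ (φ i)) (J₂ (φ i')) ≤ (n : ℝ) →
      setDistD d₁ (J₁ i) (J₁ i') ≤ (f n : ℝ))

/-- `q` pairs the collections `J₁`, `J₂` as `φ` does. -/
def PairsAsD {ι κ : Type*} (d₁ : α → α → ℝ) (d₂ : β → β → ℝ)
    (q : α → β) (J₁ : ι → Set α) (J₂ : κ → Set β) (φ : ι → κ) : Prop :=
  ∃ h : ℕ → ℕ, ∀ (n : ℕ) (p : α) (i : ι),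
    pdistD d₁ p (J₁ i) ≤ (n : ℝ) → pdistD d₂ (q p) (J₂ (φ i)) ≤ (h n : ℝ)

/-- quasi-isometry between `(α, d₁)` and `(β, d₂)`. -/
def QIMapD (d₁ : α → α → ℝ) (d₂ : β → β → ℝ) (q : α → β) : Prop :=
  ∃ lam C : ℝ, 1 ≤ lam ∧ 0 ≤ C ∧
    (∀ x y : α, d₂ (q x) (q y) ≤ lam * d₁ x y + C ∧ d₁ x y ≤ lam * d₂ (q x) (q y) + C) ∧
    (∀ z : β, ∃ x : α, d₂ z (q x) ≤ C)

/-! ### Word metrics, quasiconvex subgroups, limit sets of cosets -/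

section Groups
variable {G : Type*} [Group G]

/-- the word metric associated to a (symmetrized) generating set `S`. -/
def wdist (S : Set G) (g h : G) : ℝ :=
  sInf {r | ∃ l : List G, (∀ x ∈ l, x ∈ S ∨ x⁻¹ ∈ S) ∧ l.prod = g⁻¹ * h ∧ r = (l.length : ℝ)}

/-- the left coset `gH` as a subset of `G`. -/
def cosetSet (H : Subgroup G) (g : G) : Set G := {x | g⁻¹ * x ∈ H}

/-- `R` contains exactly one representative of each left coset of `H`. -/
def IsCosetReps (H : Subgroup G) (R : Set G) : Prop :=
  ∀ g : G, ∃! r : G, r ∈ R ∧ g⁻¹ * r ∈ H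

/-- the translate `gΛ(H)` of the limit set of `H` in the Gromov boundary:
the limit set of the coset `gH`. -/
def cosetLimitSet (S : Set G) (H : Subgroup G) (g : G) : Set (BdryD (wdist S) (1 : G)) :=
  limitSetD (wdist S) 1 (cosetSet H g)

/-- the join `J(gΛ(H))` of the translate `gΛ(H)` of the limit set of `H`. -/
def cosetJoin (S : Set G) (H : Subgroup G) (g : G) : Set G :=
  joinD (wdist S) 1 (cosetLimitSet S H g)

/-- quasiconvex subgroup w.r.t. the word metric of `S`. -/
def QCSubgroup (S : Set G) (H : Subgroup G) : Prop :=
  ∃ C ≥ (0 : ℝ), QCSetD (wdist S) C (H : Set G)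

/-- malnormal subgroup: `gHg⁻¹ ∩ H` is trivial for `g ∉ H`. -/
def Malnormal (H : Subgroup G) : Prop :=
  ∀ g : G, g ∉ H → ∀ x : G, x ∈ H → g * x * g⁻¹ ∈ H → x = 1

end Groups

/-! ### Relative hyperbolicity (Farb: electric space + bounded penetration) -/

section RelHyp
variable {α : Type*}

open Classical in
/-- cost of one step of an electric chain: travelling within a horosphere-like
set costs at most `1` (passing through the cone point). -/
def stepCost (d : α → α → ℝ) (ℋ : Set (Set α)) (a b : α) : ℝ :=
  if ∃ H ∈ ℋ, a ∈ H ∧ b ∈ H then min 1 (d a b) else d a b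

/-- electric length of the portion `[i, j]` of a chain. -/
def chainLen (d : α → α → ℝ) (ℋ : Set (Set α)) (p : ℕ → α) (i j : ℕ) : ℝ :=
  ∑ k ∈ Finset.Ico i j, stepCost d ℋ (p k) (p (k + 1))

/-- the electric (coned-off) pseudo-metric of Farb's electric space. -/
def elDist (d : α → α → ℝ) (ℋ : Set (Set α)) (x y : α) : ℝ :=
  sInf {r | ∃ (n : ℕ) (p : ℕ → α), p 0 = x ∧ p n = y ∧ r = chainLen d ℋ p 0 n}

/-- weak relative hyperbolicity: the electric space is hyperbolic. -/
def WeakRelHyp (d : α → α → ℝ) (ℋ : Set (Set α)) : Prop := HypD (elDist d ℋ)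

/-- an electric `P`-quasigeodesic chain. -/
def ElQG (d : α → α → ℝ) (ℋ : Set (Set α)) (P : ℝ) (p : ℕ → α) (n : ℕ) : Prop :=
  ∀ i j : ℕ, i ≤ j → j ≤ n → chainLen d ℋ p i j ≤ P * elDist d ℋ (p i) (p j) + P

/-- the chain does not return to the `ε`-neighbourhood of any horosphere-like
set after leaving it. -/
def NoBacktrack (d : α → α → ℝ) (ℋ : Set (Set α)) (ε : ℝ) (p : ℕ → α) (n : ℕ) : Prop :=
  ∀ H ∈ ℋ, ∀ i j k : ℕ, i < j → j < k → k ≤ n →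
    p i ∈ nbdD d ε H → p k ∈ nbdD d ε H → p j ∈ nbdD d ε H

/-- the chain meets `S`. -/
def MeetsChain (p : ℕ → α) (n : ℕ) (S : Set α) : Prop := ∃ i ≤ n, p i ∈ S

/-- `i` is the entry point of the chain into the `ε`-neighbourhood of `H`. -/
def IsEntry (d : α → α → ℝ) (ε : ℝ) (H : Set α) (p : ℕ → α) (n i : ℕ) : Prop :=
  i ≤ n ∧ p i ∈ nbdD d ε H ∧ ∀ j, j < i → p j ∉ nbdD d ε H

/-- `i` is the exit point of the chain from the `ε`-neighbourhood of `H`. -/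
def IsExit (d : α → α → ℝ) (ε : ℝ) (H : Set α) (p : ℕ → α) (n i : ℕ) : Prop :=
  i ≤ n ∧ p i ∈ nbdD d ε H ∧ ∀ j, i < j → j ≤ n → p j ∉ nbdD d ε H

/-- coarse intrinsic path-metric of a subset `S`. -/
def inDist (d : α → α → ℝ) (S : Set α) (x y : α) : ℝ :=
  sInf {r | ∃ (n : ℕ) (p : ℕ → α), p 0 = x ∧ p n = y ∧ (∀ i, i ≤ n → p i ∈ S) ∧
    (∀ i, i < n → d (p i) (p (i + 1)) ≤ 1) ∧
    r = ∑ k ∈ Finset.range n, d (p k) (p (k + 1))}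

/-- Bounded penetration: electric quasigeodesics without backtracking with the
same endpoints have similar intersection patterns with horosphere-like sets. -/
def BddPenetration (d : α → α → ℝ) (ℋ : Set (Set α)) : Prop :=
  ∀ P ≥ (1 : ℝ), ∃ ε ≥ (0 : ℝ), ∃ D ≥ (0 : ℝ),
    ∀ (p q : ℕ → α) (n m : ℕ), p 0 = q 0 → p n = q m →
      ElQG d ℋ P p n → ElQG d ℋ P q m →
      NoBacktrack d ℋ ε p n → NoBacktrack d ℋ ε q m →
      ∀ H ∈ ℋ,
        (¬ MeetsChain q m (nbdD d ε H) →
          ∀ i j, IsEntry d ε H p n i → IsExit d ε H p n j →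
            inDist d (nbdD d ε H) (p i) (p j) ≤ D) ∧
        (MeetsChain q m (nbdD d ε H) →
          (∀ i j, IsEntry d ε H p n i → IsEntry d ε H q m j →
            inDist d (nbdD d ε H) (p i) (q j) ≤ D) ∧
          (∀ i j, IsExit d ε H p n i → IsExit d ε H q m j →
            inDist d (nbdD d ε H) (p i) (q j) ≤ D))

/-- the collection `ℋ` is uniformly separated. -/
def UnifSeparated (d : α → α → ℝ) (ℋ : Set (Set α)) : Prop :=
  ∃ ε > (0 : ℝ), ∀ H₁ ∈ ℋ, ∀ H₂ ∈ ℋ, H₁ ≠ H₂ → ε ≤ setDistD d H₁ H₂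

/-- strong relative hyperbolicity (Farb's definition; equivalent to Gromov's
definition via hyperbolic cones, by Bowditch). -/
def StrongRelHyp (d : α → α → ℝ) (ℋ : Set (Set α)) : Prop :=
  UnifSeparated d ℋ ∧ WeakRelHyp d ℋ ∧ BddPenetration d ℋ

end RelHyp

/-! ### Geodesic metric spaces, CAT(0) spaces, flats, symmetric spaces -/

section MetricGeo
variable {X : Type*} [MetricSpace X]

/-- `γ` is a unit-speed parametrization of a geodesic from `x` to `y`. -/
def GeodParam (γ : ℝ → X) (x y : X) : Prop :=
  γ 0 = x ∧ γ (dist x y) = y ∧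
    ∀ s ∈ Icc (0 : ℝ) (dist x y), ∀ t ∈ Icc (0 : ℝ) (dist x y), dist (γ s) (γ t) = |s - t|

/-- `s` is (the image of) a geodesic segment from `x` to `y`. -/
def IsGeodSeg (x y : X) (s : Set X) : Prop :=
  ∃ γ : ℝ → X, GeodParam γ x y ∧ s = γ '' Icc (0 : ℝ) (dist x y)

/-- geodesic metric space. -/
def GeodesicSpace (X : Type*) [MetricSpace X] : Prop := ∀ x y : X, ∃ s : Set X, IsGeodSeg x y s

/-- `A` is a `K`-quasiconvex subset of the metric space `X`. -/
def QCSet (K : ℝ) (A : Set X) : Prop :=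
  ∀ x ∈ A, ∀ y ∈ A, ∀ s : Set X, IsGeodSeg x y s → ∀ p ∈ s, Metric.infDist p A ≤ K

/-- `γ` is a bi-infinite (unit-speed) geodesic. -/
def IsGeodLine (γ : ℝ → X) : Prop := ∀ a b : ℝ, dist (γ a) (γ b) = |a - b|

/-- both endpoints of the geodesic line `γ` lie in `Λ`. -/
def lineEndsIn (w : X) (γ : ℝ → X) (Λ : Set (BdryD (fun x y : X => dist x y) w)) : Prop :=
  (∃ ξ ∈ Λ, ConvTo (fun x y : X => dist x y) w (fun n : ℕ => γ (n : ℝ)) ξ) ∧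
  (∃ η ∈ Λ, ConvTo (fun x y : X => dist x y) w (fun n : ℕ => γ (-(n : ℝ))) η)

/-- the join of `Λ ⊆ ∂X`: the union of bi-infinite geodesics with endpoints in `Λ`. -/
def joinR (w : X) (Λ : Set (BdryD (fun x y : X => dist x y) w)) : Set X :=
  {p | ∃ γ : ℝ → X, IsGeodLine γ ∧ lineEndsIn w γ Λ ∧ p ∈ Set.range γ}

/-- CAT(0) space, via the CN (Bruhat–Tits) midpoint inequality. -/
def CAT0 (X : Type*) [MetricSpace X] : Prop :=
  GeodesicSpace X ∧ ∀ x y z m : X, dist y m = dist y z / 2 → dist z m = dist y z / 2 →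
    dist x m ^ 2 ≤ (dist x y ^ 2 + dist x z ^ 2) / 2 - dist y z ^ 2 / 4

/-- a `k`-flat: an isometrically embedded copy of Euclidean `k`-space. -/
def FlatOfDim (k : ℕ) (F : Set X) : Prop :=
  ∃ f : EuclideanSpace ℝ (Fin k) → X, Isometry f ∧ Set.range f = F

/-- a flat (of dimension at least 2). -/
def IsFlat2 (F : Set X) : Prop := ∃ k : ℕ, 2 ≤ k ∧ FlatOfDim k F

/-- a maximal flat. -/
def IsMaxFlat (F : Set X) : Prop := IsFlat2 F ∧ ∀ F' : Set X, IsFlat2 F' → F ⊆ F' → F' = F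

/-- isolated flats: every flat is uniformly close to a maximal one, and
neighbourhoods of distinct maximal flats have uniformly bounded overlap. -/
def IsolatedFlats (X : Type*) [MetricSpace X] : Prop :=
  (∃ D ≥ (0 : ℝ), ∀ F : Set X, IsFlat2 F →
    ∃ F' : Set X, IsMaxFlat F' ∧ ∀ x ∈ F, Metric.infDist x F' ≤ D) ∧
  (∀ ρ ≥ (0 : ℝ), ∃ κ ≥ (0 : ℝ), ∀ F F' : Set X, IsMaxFlat F → IsMaxFlat F' → F ≠ F' →
    ∀ x y : X, Metric.infDist x F ≤ ρ → Metric.infDist x F' ≤ ρ →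
      Metric.infDist y F ≤ ρ → Metric.infDist y F' ≤ ρ → dist x y ≤ κ)

/-- a (globally) symmetric space of non-positive curvature: a CAT(0) space with
a geodesic point-symmetry at every point. -/
def SymmSpaceNonpos (X : Type*) [MetricSpace X] : Prop :=
  CAT0 X ∧ ∀ x : X, ∃ σ : X ≃ᵢ X, σ x = x ∧ ∀ y : X, dist y (σ y) = 2 * dist x y

/-- `X` has rank `r`: it contains an `r`-flat but no `(r+1)`-flat. -/
def HasRank (X : Type*) [MetricSpace X] (r : ℕ) : Prop :=
  (∃ F : Set X, FlatOfDim r F) ∧ ∀ F : Set X, ¬ FlatOfDim (r + 1) F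

end MetricGeo

/-! ### Group actions -/

/-- a geometric action: by isometries, metrically proper and cobounded. -/
def GeometricAction (G : Type*) [Group G] (X : Type*) [MetricSpace X] [MulAction G X] : Prop :=
  (∀ g : G, Isometry (fun x : X => g • x)) ∧
  (∀ x₀ : X, ∀ r : ℝ, {g : G | dist x₀ (g • x₀) ≤ r}.Finite) ∧
  (∀ x₀ : X, ∃ C : ℝ, ∀ x : X, ∃ g : G, dist x (g • x₀) ≤ C)

/-- `𝒥` is the `G`-equivariant family of lifts of a maximal totally geodesic
torus (of dimension `r = rank`) in the compact locally symmetric space `X/G`: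
an orbit of a periodic `r`-flat. -/
def TorusLiftFamily (G : Type*) [Group G] {X : Type*} [MetricSpace X] [MulAction G X]
    (r : ℕ) (𝒥 : Set (Set X)) : Prop :=
  (∀ J ∈ 𝒥, FlatOfDim r J) ∧
  (∃ F₀ ∈ 𝒥, 𝒥 = {J : Set X | ∃ g : G, J = (fun x : X => g • x) '' F₀}) ∧
  (∃ C ≥ (0 : ℝ), ∀ J ∈ 𝒥, ∀ x ∈ J, ∀ y ∈ J,
    ∃ g : G, (fun z : X => g • z) '' J = J ∧ dist x (g • y) ≤ C)

/-! ### Convergence groups, annulus systems and cross-ratios (Bowditch) -/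

/-- the space of distinct triples of `M`. -/
def distinctTriples (M : Type*) : Set (M × M × M) :=
  {p | p.1 ≠ p.2.1 ∧ p.1 ≠ p.2.2 ∧ p.2.1 ≠ p.2.2}

/-- the diagonal action on triples. -/
def tripleAct {G M : Type*} [Group G] [MulAction G M] (g : G) (p : M × M × M) : M × M × M :=
  (g • p.1, g • p.2.1, g • p.2.2)

/-- a uniform convergence group action: the action on the space of distinct
triples is properly discontinuous and cocompact. -/
def UniformConvergenceAction (G : Type*) [Group G] (M : Type*) [TopologicalSpace M]
    [MulAction G M] : Prop :=
  (∀ g : G, Continuous (fun x : M => g • x)) ∧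
  (∀ K : Set (M × M × M), K ⊆ distinctTriples M → IsCompact K →
    {g : G | (tripleAct g '' K ∩ K).Nonempty}.Finite) ∧
  (∃ K : Set (M × M × M), K ⊆ distinctTriples M ∧ IsCompact K ∧
    ∀ p ∈ distinctTriples M, ∃ g : G, tripleAct g p ∈ K)

/-- an (unconstrained) ordered pair of subsets of `M`. -/
structure Ann (M : Type*) where
  minus : Set M
  plus : Set M

/-- `A` is an annulus: an ordered pair of disjoint closed subsets not covering `M`. -/
def IsAnnulusOn (M : Type*) [TopologicalSpace M] (A : Ann M) : Prop :=
  IsClosed A.minus ∧ IsClosed A.plus ∧ Disjoint A.minus A.plus ∧ A.minus ∪ A.plus ≠ Set.univ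

/-- translate of an annulus. -/
def annAct {G M : Type*} [Group G] [MulAction G M] (g : G) (A : Ann M) : Ann M :=
  ⟨(fun x : M => g • x) '' A.minus, (fun x : M => g • x) '' A.plus⟩

/-- a nested chain of `m` annuli of `𝒜` separating `K` from `L`:
`K < A₁ < ⋯ < A_m < L`. -/
def SepChain {M : Type*} [TopologicalSpace M] (𝒜 : Set (Ann M)) (K L : Set M) (m : ℕ) : Prop :=
  m = 0 ∨ ∃ A : ℕ → Ann M, (∀ i, i < m → A i ∈ 𝒜) ∧
    K ⊆ interior (A 0).minus ∧ L ⊆ interior (A (m - 1)).plus ∧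
    ∀ i, i + 1 < m → interior (A i).minus ∪ interior (A (i + 1)).plus = Set.univ

/-- the annular cross-ratio `(K|L)_𝒜 ∈ ℕ ∪ {∞}`. -/
def crossRatioAnn {M : Type*} [TopologicalSpace M] (𝒜 : Set (Ann M)) (K L : Set M) : ℕ∞ :=
  sSup {n : ℕ∞ | ∃ m : ℕ, n = (m : ℕ∞) ∧ SepChain 𝒜 K L m}

/-- the limit set of a subgroup of a convergence group. -/
def convLimitSet {G : Type*} [Group G] {M : Type*} [TopologicalSpace M] [MulAction G M]
    (H : Subgroup G) : Set M :=
  {ξ : M | ∃ h : ℕ → H, Function.Injective h ∧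
    ∃ x : M, Tendsto (fun n => (h n : G) • x) atTop (nhds ξ)}

/-- discreteness of a family (multiset) of subsets of a metrizable compactum `M`
in the Hausdorff topology on the space of closed subsets of `M` with more than
one point. -/
def DiscreteFamilyM {ι M : Type*} [MetricSpace M] (L : ι → Set M) : Prop :=
  ∀ K : Set M, IsClosed K → K.Nontrivial →
    ¬ (∀ ε > (0 : ℝ), {i : ι | Metric.hausdorffDist (L i) K < ε}.Infinite)

/-- uniform properness of a pairing with respect to annular cross-ratios. -/
def UProperCRFam {ι κ M₁ M₂ : Type*} [TopologicalSpace M₁] [TopologicalSpace M₂]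
    (𝒜₁ : Set (Ann M₁)) (𝒜₂ : Set (Ann M₂))
    (L₁ : ι → Set M₁) (L₂ : κ → Set M₂) (φ : ι → κ) : Prop :=
  ∃ f : ℕ → ℕ, ∀ (n : ℕ) (i i' : ι),
    (crossRatioAnn 𝒜₁ (L₁ i) (L₁ i') ≤ (n : ℕ∞) →
      crossRatioAnn 𝒜₂ (L₂ (φ i)) (L₂ (φ i')) ≤ (f n : ℕ∞)) ∧
    (crossRatioAnn 𝒜₂ (L₂ (φ i)) (L₂ (φ i')) ≤ (n : ℕ∞) →
      crossRatioAnn 𝒜₁ (L₁ i) (L₁ i') ≤ (f n : ℕ∞))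

/-! ### Hyperbolic geometry of discrete geodesic spaces -/

/-- basic properties of a discrete geodesic metric. -/
structure GeoD {α : Type*} (d : α → α → ℝ) : Prop where
  self : ∀ x, d x x = 0
  symm : ∀ x y, d x y = d y x
  tri : ∀ x y z, d x z ≤ d x y + d y z
  geod : ∀ x y, ∃ (c : ℕ → α) (m : ℕ), DiscGeodD d c m ∧ c 0 = x ∧ c m = y

section Abstract
variable {α β : Type*} {d : α → α → ℝ} {d' : β → β → ℝ}

lemma GeoD.nonneg (h : GeoD d) (x y : α) : 0 ≤ d x y := by
  have h1 := h.tri x y x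
  rw [h.self, h.symm y x] at h1
  linarith

lemma gp_symm (h : GeoD d) (w x y : α) : gpD d w x y = gpD d w y x := by
  unfold gpD; rw [h.symm x y]; ring

lemma gp_base (h : GeoD d) (w w' x y : α) : gpD d w x y ≤ gpD d w' x y + d w w' := by
  unfold gpD
  have h1 := h.tri w w' x
  have h2 := h.tri w w' y
  linarith

lemma gp_ge_left (h : GeoD d) (w x y : α) : d w x - d x y ≤ gpD d w x y := by
  unfold gpD
  have h1 := h.tri w y x
  rw [h.symm y x] at h1
  linarith

lemma gp_move (h : GeoD d) (w x y z : α) : gpD d w x y - d y z ≤ gpD d w x z := by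
  unfold gpD
  have h1 := h.tri w z y
  have h2 := h.tri x y z
  rw [h.symm z y] at h1
  linarith

lemma gp_le_of_geod (h : GeoD d) {c : ℕ → α} {m : ℕ} (hc : DiscGeodD d c m) (p : α) {i : ℕ}
    (hi : i ≤ m) : gpD d p (c 0) (c m) ≤ d p (c i) := by
  unfold gpD
  have h1 := h.tri p (c i) (c 0)
  have h2 := h.tri p (c i) (c m)
  have e1 := hc i hi 0 (Nat.zero_le _)
  have e2 := hc i hi m le_rfl
  have e3 := hc 0 (Nat.zero_le _) m le_rfl
  have hi' : (i : ℝ) ≤ m := by exact_mod_cast hi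
  have hi0 : (0 : ℝ) ≤ i := Nat.cast_nonneg _
  rw [abs_of_nonneg (by simp)] at e1
  rw [abs_of_nonpos (by linarith)] at e2
  rw [abs_of_nonpos (by simp)] at e3
  push_cast at *
  linarith

lemma hyp_or {δ : ℝ} (hδ : DeltaHypD d δ) (w x y z : α) :
    gpD d w x y ≤ gpD d w x z + δ ∨ gpD d w y z ≤ gpD d w x z + δ := by
  have := hδ w x y z
  rcases min_choice (gpD d w x y) (gpD d w y z) with h | h <;> rw [h] at this
  · left; linarith
  · right; linarith

lemma near_geod (h : GeoD d) {δ : ℝ} (hδ : DeltaHypD d δ) {c : ℕ → α} {m : ℕ}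
    (hc : DiscGeodD d c m) (p : α) :
    ∃ i ≤ m, d p (c i) ≤ gpD d p (c 0) (c m) + 2 * δ + 1 := by
  have e3 := hc 0 (Nat.zero_le _) m le_rfl
  rw [abs_of_nonpos (by simp)] at e3
  have t0 : 0 ≤ gpD d (c 0) p (c m) := by
    unfold gpD
    have := h.tri p (c 0) (c m)
    rw [h.symm p (c 0)] at this
    linarith
  have t1 : gpD d (c 0) p (c m) ≤ m := by
    unfold gpD
    have := h.tri (c 0) (c m) p
    rw [h.symm (c m) p] at this
    push_cast at e3
    linarith
  refine ⟨⌊gpD d (c 0) p (c m)⌋₊, ?_, ?_⟩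
  · exact Nat.floor_le_of_le t1
  · set i := ⌊gpD d (c 0) p (c m)⌋₊ with hidef
    have hi : i ≤ m := Nat.floor_le_of_le t1
    have f1 : (i : ℝ) ≤ gpD d (c 0) p (c m) := Nat.floor_le t0
    have f2 : gpD d (c 0) p (c m) < i + 1 := Nat.lt_floor_add_one _
    have e1 := hc i hi 0 (Nat.zero_le _)
    have e2 := hc i hi m le_rfl
    have hi' : (i : ℝ) ≤ m := by exact_mod_cast hi
    have hi0 : (0 : ℝ) ≤ i := Nat.cast_nonneg _
    rw [abs_of_nonneg (by simp)] at e1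
    rw [abs_of_nonpos (by linarith)] at e2
    push_cast at *
    have s1 := h.symm p (c 0)
    have s2 := h.symm p (c i)
    have s3 := h.symm p (c m)
    have s4 := h.symm (c i) (c 0)
    rcases hyp_or hδ (c i) (c 0) p (c m) with h1 | h1 <;> unfold gpD at * <;> linarith

/-! ### Gromov sequences and the boundary -/

lemma tend_iff (F : ℕ × ℕ → ℝ) : Tendsto F atTop atTop ↔
    ∀ B : ℝ, ∃ N : ℕ, ∀ m ≥ N, ∀ n ≥ N, B ≤ F (m, n) := by
  rw [Filter.tendsto_atTop_atTop]
  constructor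
  · intro h B
    obtain ⟨i, hi⟩ := h B
    refine ⟨max i.1 i.2, fun m hm n hn => hi (m, n) ⟨?_, ?_⟩⟩
    · exact le_trans (le_max_left _ _) hm
    · exact le_trans (le_max_right _ _) hn
  · intro h B
    obtain ⟨N, hN⟩ := h B
    exact ⟨(N, N), fun a ha => hN a.1 ha.1 a.2 ha.2⟩

lemma rel_equiv (h : GeoD d) (hh : HypD d) (w : α) : Equivalence (bdryRelD d w) := by
  obtain ⟨δ, hδ0, hδ⟩ := hh
  constructor
  · intro s; exact s.2
  · intro s t hst
    unfold bdryRelD at *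
    rw [tend_iff] at *
    intro B
    obtain ⟨N, hN⟩ := hst B
    refine ⟨N, fun m hm n hn => ?_⟩
    rw [gp_symm h]
    exact hN n hn m hm
  · intro s t u hst htu
    unfold bdryRelD at *
    rw [tend_iff] at *
    intro B
    obtain ⟨N, hN⟩ := hst (B + δ)
    obtain ⟨N', hN'⟩ := htu (B + δ)
    refine ⟨max N N', fun m hm n hn => ?_⟩
    have h1 := hN m (le_trans (le_max_left _ _) hm) (max N N') (le_max_left _ _)
    have h2 := hN' (max N N') (le_max_right _ _) n (le_trans (le_max_right _ _) hn)
    rcases hyp_or hδ w (s.1 m) (t.1 (max N N')) (u.1 n) with h3 | h3 <;> simp only at * <;> linarith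

lemma conv_rel (h : GeoD d) (hh : HypD d) {w : α} {s t : ℕ → α} {ξ : BdryD d w}
    (hs : ConvTo d w s ξ) (ht : ConvTo d w t ξ) :
    ∀ B : ℝ, ∃ N : ℕ, ∀ m ≥ N, ∀ n ≥ N, B ≤ gpD d w (s m) (t n) := by
  obtain ⟨hs, rfl⟩ := hs
  obtain ⟨ht, e⟩ := ht
  have e' : Relation.EqvGen (bdryRelD d w) ⟨s, hs⟩ ⟨t, ht⟩ := (Quot.eq).1 e.symm
  rw [(rel_equiv h hh w).eqvGen_iff] at e'
  exact (tend_iff _).1 e'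

lemma conv_perturb (h : GeoD d) {w : α} {s t : ℕ → α} {ξ : BdryD d w} {K : ℝ}
    (hs : ConvTo d w s ξ) (hst : ∀ n, d (s n) (t n) ≤ K) : ConvTo d w t ξ := by
  obtain ⟨hs, rfl⟩ := hs
  have hr : ∀ B : ℝ, ∃ N : ℕ, ∀ m ≥ N, ∀ n ≥ N, B ≤ gpD d w (s m) (t n) := by
    intro B
    obtain ⟨N, hN⟩ := (tend_iff _).1 hs (B + K)
    refine ⟨N, fun m hm n hn => ?_⟩
    have := hN m hm n hn
    have h1 := gp_move h w (s m) (s n) (t n)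
    have h2 := hst n
    simp only at this
    linarith
  have ht : GromovSeqD d w t := by
    unfold GromovSeqD
    rw [tend_iff]
    intro B
    obtain ⟨N, hN⟩ := hr (B + K)
    refine ⟨N, fun m hm n hn => ?_⟩
    have := hN m hm n hn
    have h1 := gp_move h w (t n) (s m) (t m)
    have h2 := hst m
    rw [gp_symm h w (t n), gp_symm h w (t n)] at h1
    simp only
    linarith
  refine ⟨ht, (Quot.sound ?_).symm⟩
  exact (tend_iff _).2 hr

lemma conv_of_rel {w : α} {s t : ℕ → α} {ξ : BdryD d w}
    (hs : ConvTo d w s ξ) (ht : GromovSeqD d w t)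
    (hr : ∀ B : ℝ, ∃ N : ℕ, ∀ m ≥ N, ∀ n ≥ N, B ≤ gpD d w (s m) (t n)) : ConvTo d w t ξ := by
  obtain ⟨hs, rfl⟩ := hs
  refine ⟨ht, (Quot.sound ?_).symm⟩
  exact (tend_iff _).2 hr

/-- a geodesic ray is a Gromov sequence -/
lemma ray_gromov (h : GeoD d) (w : α) (c : ℕ → α)
    (hc : ∀ i j : ℕ, d (c i) (c j) = |(i : ℝ) - j|) : GromovSeqD d w c := by
  unfold GromovSeqD
  rw [tend_iff]
  intro B
  obtain ⟨N, hN⟩ := exists_nat_ge (B + d w (c 0))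
  refine ⟨N, fun m hm n hn => ?_⟩
  have h1 := gp_base h (c 0) w (c m) (c n)
  have h2 : (N : ℝ) ≤ gpD d (c 0) (c m) (c n) := by
    have hm' : (N : ℝ) ≤ m := by exact_mod_cast hm
    have hn' : (N : ℝ) ≤ n := by exact_mod_cast hn
    have a0 : (0 : ℝ) ≤ m := Nat.cast_nonneg _
    have b0 : (0 : ℝ) ≤ n := Nat.cast_nonneg _
    unfold gpD
    rw [hc, hc, hc, Nat.cast_zero, zero_sub, zero_sub, abs_neg, abs_neg, abs_of_nonneg a0,
      abs_of_nonneg b0]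
    rcases abs_cases ((m : ℝ) - n) with ⟨e, _⟩ | ⟨e, _⟩ <;> rw [e] <;> linarith
  rw [h.symm (c 0) w] at h1
  simp only
  linarith

/-! ### The Morse lemma -/

lemma dyadic {δ : ℝ} (hδ : DeltaHypD d δ) (p : α) (b : ℕ → α) (n : ℕ) (E : ℝ)
    (hb : ∀ j k, j ≤ k → k ≤ j + 1 → k ≤ n → E ≤ gpD d p (b j) (b k)) :
    ∀ L a a' : ℕ, a ≤ a' → a' ≤ a + 2 ^ L → a' ≤ n → E - δ * L ≤ gpD d p (b a) (b a') := by
  intro L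
  induction L with
  | zero =>
    intro a a' h1 h2 h3
    simpa using hb a a' h1 (by simpa using h2) h3
  | succ L ih =>
    intro a a' h1 h2 h3
    have hp : 2 ^ (L + 1) = 2 ^ L + 2 ^ L := by ring
    have m1 := ih a (min (a + 2 ^ L) a') (by omega) (by omega) (by omega)
    have m2 := ih (min (a + 2 ^ L) a') a' (by omega) (by omega) (by omega)
    push_cast
    rcases hyp_or hδ p (b a) (b (min (a + 2 ^ L) a')) (b a') with h4 | h4 <;> linarith

lemma exp_beats (a b : ℝ) : ∃ L₀ : ℕ, ∀ L : ℕ, L₀ ≤ L → a * L + b < 2 ^ L := by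
  have h1 := tendsto_self_mul_const_pow_of_lt_one (r := (1 / 2 : ℝ)) (by norm_num) (by norm_num)
  have h2 := tendsto_pow_atTop_nhds_zero_of_lt_one (r := (1 / 2 : ℝ)) (by norm_num) (by norm_num)
  have h3 := (h1.const_mul a).add (h2.const_mul b)
  simp only [mul_zero, add_zero] at h3
  have h4 := h3.eventually (gt_mem_nhds (show (0 : ℝ) < 1 by norm_num))
  obtain ⟨L₀, hL⟩ := Filter.eventually_atTop.1 h4
  refine ⟨L₀, fun L h => ?_⟩
  have := hL L h
  have hp : (0 : ℝ) < 2 ^ L := by positivity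
  rw [one_div, inv_pow] at this
  have e : a * (↑L * (2 ^ L)⁻¹) + b * (2 ^ L)⁻¹ = (a * L + b) / 2 ^ L := by
    field_simp
  rw [e, div_lt_one hp] at this
  exact this

lemma exists_max_far (d : α → α → ℝ) (c b : ℕ → α) (m n : ℕ) :
    ∃ i₀ ≤ m, ∃ D : ℝ, (∀ j ≤ n, D ≤ d (c i₀) (b j)) ∧ ∀ i ≤ m, ∃ j ≤ n, d (c i) (b j) ≤ D := by
  have h1 : ∀ i, ∃ j ≤ n, ∀ j' ≤ n, d (c i) (b j) ≤ d (c i) (b j') := by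
    intro i
    obtain ⟨j, hj, hj'⟩ := Finset.exists_min_image (Finset.range (n + 1))
      (fun j => d (c i) (b j)) ⟨0, by simp⟩
    exact ⟨j, by simpa [Nat.lt_succ_iff] using hj,
      fun j' h => hj' j' (by simpa [Nat.lt_succ_iff] using h)⟩
  choose J hJ hJm using h1
  obtain ⟨i, hi, hi'⟩ := Finset.exists_max_image (Finset.range (m + 1))
      (fun i => d (c i) (b (J i))) ⟨0, by simp⟩
  refine ⟨i, by simpa [Nat.lt_succ_iff] using hi, d (c i) (b (J i)), hJm i, fun i' h => ?_⟩
  exact ⟨J i', hJ i', hi' i' (by simpa [Nat.lt_succ_iff] using h)⟩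

lemma morse_side (h : GeoD d) {c b : ℕ → α} {i₀ : ℕ} {D K : ℝ} (hK : 0 ≤ K)
    {i j : ℕ} (hfar : D ≤ d (c i₀) (b j))
    (hor : (d (c i) (b j) ≤ D ∧ 2 * D ≤ d (c i₀) (c i)) ∨ d (c i) (b j) ≤ K) :
    D - K ≤ gpD d (c i₀) (c i) (b j) := by
  rcases hor with ⟨h1, h2⟩ | h1
  · unfold gpD; linarith
  · have := gp_ge_left h (c i₀) (b j) (c i)
    rw [gp_symm h, h.symm (b j) (c i)] at this
    linarith

/-- First half of the Morse lemma. -/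
lemma morse (h : GeoD d) (hh : HypD d) (K : ℝ) (hK : 0 ≤ K) : ∃ M : ℝ, 0 ≤ M ∧
    ∀ (c b : ℕ → α) (m n : ℕ), DiscGeodD d c m → d (c 0) (b 0) ≤ K → d (c m) (b n) ≤ K →
      (∀ j, j + 1 ≤ n → d (b j) (b (j + 1)) ≤ K) →
      (∀ j k, j ≤ k → k ≤ n → (k : ℝ) - j ≤ K * d (b j) (b k) + K) →
      ∀ i ≤ m, ∃ j ≤ n, d (c i) (b j) ≤ M := by
  obtain ⟨δ, hδ0, hδ⟩ := hh
  obtain ⟨L₀, hL₀⟩ := exp_beats (2 * (K * (6 * δ))) (2 * (K * (6 * (K + 3 * δ) + 2 * K + 2) + K + 1))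
  refine ⟨K + 3 * δ + δ * L₀, by positivity, ?_⟩
  intro c b m n hc h0 hm hstep hqg i hi
  obtain ⟨i₀, hi₀, D, hfar, hnear⟩ := exists_max_far d c b m n
  suffices hD : D ≤ K + 3 * δ + δ * L₀ by
    obtain ⟨j, hj, hj'⟩ := hnear i hi
    exact ⟨j, hj, hj'.trans hD⟩
  by_contra hcon
  push Not at hcon
  have hD0 : 0 ≤ D := le_trans (by positivity) hcon.le
  have dc : ∀ x y, x ≤ m → y ≤ m → x ≤ y → d (c x) (c y) = (y : ℝ) - x := by
    intro x y hx hy hxy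
    rw [hc x hx y hy, abs_of_nonpos]
    · ring
    · have : (x : ℝ) ≤ y := by exact_mod_cast hxy
      linarith
  set T := ⌈2 * D⌉₊ with hT
  have hT1 : 2 * D ≤ T := Nat.le_ceil _
  have hT2 : (T : ℝ) < 2 * D + 1 := Nat.ceil_lt_add_one (by linarith)
  -- left side
  obtain ⟨y, hy, hyi, j1, hj1, hyT, hl, hor1⟩ : ∃ y, y ≤ m ∧ y ≤ i₀ ∧ ∃ j1, j1 ≤ n ∧
      d (c i₀) (c y) ≤ T ∧ d (c y) (b j1) ≤ D + K ∧
      ((d (c y) (b j1) ≤ D ∧ 2 * D ≤ d (c i₀) (c y)) ∨ d (c y) (b j1) ≤ K) := by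
    by_cases hle : T ≤ i₀
    · obtain ⟨j, hj, hj'⟩ := hnear (i₀ - T) (by omega)
      have e := dc (i₀ - T) i₀ (by omega) hi₀ (by omega)
      rw [h.symm] at e
      push_cast [hle] at e
      refine ⟨i₀ - T, by omega, by omega, j, hj, by linarith, by linarith, Or.inl ⟨hj', by linarith⟩⟩
    · have e := dc 0 i₀ (by omega) hi₀ (by omega)
      rw [h.symm] at e
      push_cast at e
      have : (i₀ : ℝ) ≤ T := by exact_mod_cast (by omega : i₀ ≤ T)
      exact ⟨0, by omega, by omega, 0, by omega, by linarith, by linarith, Or.inr h0⟩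
  obtain ⟨z, hz, hzi, j2, hj2, hzT, hr, hor2⟩ : ∃ z, z ≤ m ∧ i₀ ≤ z ∧ ∃ j2, j2 ≤ n ∧
      d (c i₀) (c z) ≤ T ∧ d (c z) (b j2) ≤ D + K ∧
      ((d (c z) (b j2) ≤ D ∧ 2 * D ≤ d (c i₀) (c z)) ∨ d (c z) (b j2) ≤ K) := by
    by_cases hle : i₀ + T ≤ m
    · obtain ⟨j, hj, hj'⟩ := hnear (i₀ + T) (by omega)
      have e := dc i₀ (i₀ + T) hi₀ (by omega) (by omega)
      push_cast at e
      refine ⟨i₀ + T, by omega, by omega, j, hj, by linarith, by linarith, Or.inl ⟨hj', by linarith⟩⟩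
    · have e := dc i₀ m hi₀ le_rfl hi₀
      have : (m : ℝ) ≤ i₀ + T := by exact_mod_cast (by omega : m ≤ i₀ + T)
      exact ⟨m, le_rfl, hi₀, n, le_rfl, by linarith, by linarith, Or.inr hm⟩
  have g1 := morse_side h hK (hfar j1 hj1) hor1
  have g2 := morse_side h hK (hfar j2 hj2) hor2
  have g0 : gpD d (c i₀) (c y) (c z) = 0 := by
    unfold gpD
    rw [h.symm (c i₀) (c y), dc y i₀ hy hi₀ hyi, dc i₀ z hi₀ hz hzi, dc y z hy hz (hyi.trans hzi)]
    ring
  have hjj : d (b j1) (b j2) ≤ 6 * D + 2 * K + 2 := by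
    have t1 := h.tri (b j1) (c y) (b j2)
    have t2 := h.tri (c y) (c z) (b j2)
    have t3 := h.tri (c y) (c i₀) (c z)
    rw [h.symm (b j1) (c y)] at t1
    rw [h.symm (c y) (c i₀)] at t3
    linarith
  have hb : ∀ j k, j ≤ k → k ≤ j + 1 → k ≤ n → D - K ≤ gpD d (c i₀) (b j) (b k) := by
    intro j k h1 h2 h3
    have e1 := gp_ge_left h (c i₀) (b j) (b k)
    have e2 := hfar j (by omega)
    have e3 : d (b j) (b k) ≤ K := by
      rcases (by omega : k = j ∨ k = j + 1) with rfl | rfl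
      · rw [h.self]; exact hK
      · exact hstep j h3
    linarith
  -- number of steps
  have key : ∀ u v, u ≤ v → v ≤ n → d (b u) (b v) ≤ 6 * D + 2 * K + 2 →
      ∃ L : ℕ, (2 : ℝ) ^ L ≤ 2 * (K * (6 * D + 2 * K + 2) + K + 1) ∧
        D - K - δ * L ≤ gpD d (c i₀) (b u) (b v) := by
    intro u v huv hv hd
    refine ⟨Nat.clog 2 (v - u), ?_, dyadic hδ _ b n _ hb _ u v huv ?_ hv⟩
    · have q1 := hqg u v huv hv
      have q2 : K * d (b u) (b v) ≤ K * (6 * D + 2 * K + 2) := mul_le_mul_of_nonneg_left hd hK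
      by_cases h1 : v - u ≤ 1
      · rw [Nat.clog_of_right_le_one h1]
        have : 0 ≤ K * (6 * D + 2 * K + 2) := by positivity
        norm_num
        linarith
      · have h2 : 1 < v - u := by omega
        have h3 := Nat.pow_pred_clog_lt_self (b := 2) (by norm_num) h2
        have h4 : 0 < Nat.clog 2 (v - u) := Nat.clog_pos (by norm_num) h2
        have h5 : (2 : ℕ) ^ Nat.clog 2 (v - u) < 2 * (v - u) := by
          obtain ⟨k, hk⟩ := Nat.exists_eq_succ_of_ne_zero h4.ne'
          rw [hk] at h3 ⊢
          simp only [Nat.pred_succ, Nat.succ_eq_add_one, pow_succ] at *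
          omega
        have h6 : ((2 : ℕ) ^ Nat.clog 2 (v - u) : ℝ) < 2 * ((v - u : ℕ) : ℝ) := by exact_mod_cast h5
        push_cast [huv] at h6
        linarith
    · have := Nat.le_pow_clog (b := 2) (by norm_num) (v - u)
      omega
  obtain ⟨L, hL1, hL2⟩ : ∃ L : ℕ, (2 : ℝ) ^ L ≤ 2 * (K * (6 * D + 2 * K + 2) + K + 1) ∧
        D - K - δ * L ≤ gpD d (c i₀) (b j1) (b j2) := by
    rcases le_total j1 j2 with hle | hle
    · exact key j1 j2 hle hj2 hjj
    · obtain ⟨L, h1, h2⟩ := key j2 j1 hle hj1 (by rw [h.symm]; exact hjj)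
      exact ⟨L, h1, by rw [gp_symm h]; exact h2⟩
  have hδL : 0 ≤ δ * L := by positivity
  have hDL : D ≤ K + 2 * δ + δ * L := by
    rw [gp_symm h] at g2
    rcases hyp_or hδ (c i₀) (c y) (b j1) (c z) with e1 | e1
    · linarith
    · rcases hyp_or hδ (c i₀) (b j1) (b j2) (c z) with e2 | e2 <;> linarith
  have hLlt : L < L₀ := by
    by_contra hge
    have e1 := hL₀ L (by omega)
    have e2 : K * (6 * D + 2 * K + 2) ≤ K * (6 * (K + 3 * δ + δ * L) + 2 * K + 2) :=
      mul_le_mul_of_nonneg_left (by linarith) hK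
    linarith
  have : δ * (L : ℝ) ≤ δ * L₀ := mul_le_mul_of_nonneg_left (by exact_mod_cast hLlt.le) hδ0
  linarith

/-- A quasi-isometry coarsely preserves boundedness of Gromov products. -/
lemma qi_gp (h : GeoD d) (hh : HypD d) (h' : GeoD d') {q : α → β} (hq : QIMapD d d' q) (B : ℝ) :
    ∃ A : ℝ, ∀ w x y, gpD d w x y ≤ B → gpD d' (q w) (q x) (q y) ≤ A := by
  obtain ⟨l, C, hl, hC, hqi, hsurj⟩ := hq
  set K := l * (1 + 2 * C) + 3 * C with hKdef
  have hlC : 0 ≤ l * C := by positivity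
  have hlK : l ≤ K := by nlinarith
  have hK : 0 ≤ K := by linarith
  obtain ⟨M, hM0, hM⟩ := morse h hh K hK
  obtain ⟨δ, hδ0, hδ⟩ := hh
  refine ⟨l * (B + 2 * δ + 1 + M) + 2 * C, ?_⟩
  intro w x y hB
  obtain ⟨c, m, hc, rfl, rfl⟩ := h.geod x y
  obtain ⟨e, n, he, he0, hen⟩ := h'.geod (q (c 0)) (q (c m))
  choose P hP using hsurj
  obtain ⟨i, hi, hwi⟩ := near_geod h hδ hc w
  have hPP : ∀ j k, j ≤ n → k ≤ n →
      d (P (e j)) (P (e k)) ≤ l * (d' (e j) (e k) + 2 * C) + C ∧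
      d' (e j) (e k) ≤ l * d (P (e j)) (P (e k)) + 3 * C := by
    intro j k hj hk
    have q1 := hqi (P (e j)) (P (e k))
    have t1 := h'.tri (q (P (e j))) (e j) (q (P (e k)))
    have t2 := h'.tri (e j) (e k) (q (P (e k)))
    have t3 := h'.tri (e j) (q (P (e j))) (e k)
    have t4 := h'.tri (q (P (e j))) (q (P (e k))) (e k)
    have s1 := h'.symm (q (P (e j))) (e j)
    have s2 := h'.symm (q (P (e k))) (e k)
    have p1 := hP (e j)
    have p2 := hP (e k)
    constructor
    · refine q1.2.trans ?_
      have : l * d' (q (P (e j))) (q (P (e k))) ≤ l * (d' (e j) (e k) + 2 * C) :=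
        mul_le_mul_of_nonneg_left (by linarith) (by linarith)
      linarith
    · linarith
  have hend : ∀ x, d x (P (q x)) ≤ K := by
    intro x
    have q1 := (hqi x (P (q x))).2
    have p1 := hP (q x)
    have : l * d' (q x) (q (P (q x))) ≤ l * C := mul_le_mul_of_nonneg_left p1 (by linarith)
    rw [hKdef]; nlinarith
  obtain ⟨j, hj, hj'⟩ := hM c (fun j => P (e j)) m n hc (by simpa [he0] using hend (c 0))
    (by simpa [hen] using hend (c m)) (by
      intro j hj
      have := (hPP j (j + 1) (by omega) hj).1
      rw [he j (by omega) (j + 1) hj] at this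
      push_cast at this
      rw [show (j : ℝ) - (j + 1) = -1 by ring, abs_neg, abs_one] at this
      linarith) (by
      intro j k hjk hk
      have := (hPP j k (by omega) hk).2
      rw [he j (by omega) k hk] at this
      have h1 : (k : ℝ) - j ≤ |(j : ℝ) - k| := by rw [abs_sub_comm]; exact le_abs_self _
      have h2 : l * d (P (e j)) (P (e k)) ≤ K * d (P (e j)) (P (e k)) :=
        mul_le_mul_of_nonneg_right hlK (h.nonneg _ _)
      nlinarith) i hi
  have g := gp_le_of_geod h' he (q w) hj
  rw [he0, hen] at g
  have t0 := h.tri w (c i) (P (e j))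
  have t1 := h'.tri (q w) (q (P (e j))) (e j)
  have q1 := (hqi w (P (e j))).1
  have p1 := hP (e j)
  rw [h'.symm] at p1
  have : l * d w (P (e j)) ≤ l * (B + 2 * δ + 1 + M) :=
    mul_le_mul_of_nonneg_left (by linarith) (by linarith)
  linarith

lemma qi_pull (h : GeoD d) (hh : HypD d) (h' : GeoD d') {q : α → β} (hq : QIMapD d d' q)
    (w : α) (w' : β) (s t : ℕ → α)
    (hst : ∀ B : ℝ, ∃ N : ℕ, ∀ m ≥ N, ∀ n ≥ N, B ≤ gpD d' w' (q (s m)) (q (t n))) :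
    ∀ B : ℝ, ∃ N : ℕ, ∀ m ≥ N, ∀ n ≥ N, B ≤ gpD d w (s m) (t n) := by
  intro B
  obtain ⟨A, hA⟩ := qi_gp h hh h' hq B
  obtain ⟨N, hN⟩ := hst (A + d' w' (q w) + 1)
  refine ⟨N, fun m hm n hn => ?_⟩
  by_contra hlt
  push Not at hlt
  have h1 := hA w _ _ hlt.le
  have h2 := hN m hm n hn
  have h3 := gp_base h' w' (q w) (q (s m)) (q (t n))
  linarith

lemma pdist_le {x : α} {A : Set α} (hA : A.Nonempty) {r : ℝ} (hr : pdistD d x A ≤ r) :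
    ∃ a ∈ A, d x a ≤ r + 1 := by
  obtain ⟨a, ha⟩ := hA
  obtain ⟨_, ⟨b, hb, rfl⟩, h2⟩ := exists_lt_of_csInf_lt (s := {r | ∃ a ∈ A, r = d x a})
    ⟨_, a, ha, rfl⟩ (lt_of_le_of_lt hr (lt_add_one r))
  exact ⟨b, hb, h2.le⟩

lemma le_pdist (h : GeoD d) {x : α} {A : Set α} {a : α} (ha : a ∈ A) : pdistD d x A ≤ d x a :=
  csInf_le ⟨0, by rintro _ ⟨b, _, rfl⟩; exact h.nonneg _ _⟩ ⟨a, ha, rfl⟩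

lemma setDist_le {A B : Set α} (hA : A.Nonempty) (hB : B.Nonempty) {r : ℝ}
    (hr : setDistD d A B ≤ r) : ∃ a ∈ A, ∃ b ∈ B, d a b ≤ r + 1 := by
  obtain ⟨a, ha⟩ := hA
  obtain ⟨b, hb⟩ := hB
  obtain ⟨_, ⟨a', ha', b', hb', rfl⟩, h2⟩ :=
    exists_lt_of_csInf_lt (s := {r | ∃ a ∈ A, ∃ b ∈ B, r = d a b})
    ⟨_, a, ha, b, hb, rfl⟩ (lt_of_le_of_lt hr (lt_add_one r))
  exact ⟨a', ha', b', hb', h2.le⟩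

lemma le_setDist (h : GeoD d) {A B : Set α} {a b : α} (ha : a ∈ A) (hb : b ∈ B) :
    setDistD d A B ≤ d a b :=
  csInf_le ⟨0, by rintro _ ⟨a, _, b, _, rfl⟩; exact h.nonneg _ _⟩ ⟨a, ha, b, hb, rfl⟩

end Abstract

/-! ### Word metrics -/

section WordMetric
variable {G : Type*} [Group G] {S : Set G}

lemma wdist_le {g k : G} {l : List G} (hl : ∀ x ∈ l, x ∈ S ∨ x⁻¹ ∈ S)
    (hp : l.prod = g⁻¹ * k) : wdist S g k ≤ l.length :=
  csInf_le ⟨0, by rintro _ ⟨l, _, _, rfl⟩; positivity⟩ ⟨l, hl, hp, rfl⟩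

lemma wdist_word (hgen : Subgroup.closure S = ⊤) (g k : G) :
    ∃ l : List G, (∀ x ∈ l, x ∈ S ∨ x⁻¹ ∈ S) ∧ l.prod = g⁻¹ * k ∧ wdist S g k = l.length := by
  classical
  have hex : ∃ n : ℕ, ∃ l : List G, (∀ x ∈ l, x ∈ S ∨ x⁻¹ ∈ S) ∧ l.prod = g⁻¹ * k ∧
      l.length = n := by
    have hm : g⁻¹ * k ∈ (Subgroup.closure S).toSubmonoid := by rw [hgen]; trivial
    rw [Subgroup.closure_toSubmonoid] at hm
    obtain ⟨l, h1, h2⟩ := Submonoid.exists_list_of_mem_closure hm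
    exact ⟨l.length, l, fun x hx => by simpa using h1 x hx, h2, rfl⟩
  obtain ⟨l, h1, h2, h3⟩ := Nat.find_spec hex
  refine ⟨l, h1, h2, ?_⟩
  apply IsLeast.csInf_eq
  refine ⟨⟨l, h1, h2, rfl⟩, ?_⟩
  rintro _ ⟨l', h1', h2', rfl⟩
  rw [h3]
  exact_mod_cast Nat.find_min' hex ⟨l', h1', h2', rfl⟩

lemma wdist_left (x g k : G) : wdist S (x * g) (x * k) = wdist S g k := by
  unfold wdist
  have : (x * g)⁻¹ * (x * k) = g⁻¹ * k := by group
  rw [this]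

lemma wdist_geo (hgen : Subgroup.closure S = ⊤) : GeoD (wdist S) := by
  have tri : ∀ x y z, wdist S x z ≤ wdist S x y + wdist S y z := by
    intro x y z
    obtain ⟨l, h1, h2, h3⟩ := wdist_word hgen x y
    obtain ⟨l', h1', h2', h3'⟩ := wdist_word hgen y z
    rw [h3, h3']
    have := wdist_le (S := S) (g := x) (k := z) (l := l ++ l') (by
      intro a ha
      rcases List.mem_append.1 ha with ha | ha
      · exact h1 a ha
      · exact h1' a ha) (by rw [List.prod_append, h2, h2']; group)
    rw [List.length_append] at this
    push_cast at this
    exact this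
  have sle : ∀ x y, wdist S x y ≤ wdist S y x := by
    intro x y
    obtain ⟨l, h1, h2, h3⟩ := wdist_word hgen y x
    rw [h3]
    have := wdist_le (S := S) (g := x) (k := y) (l := (l.map (·⁻¹)).reverse) (by
      intro a ha
      simp only [List.mem_reverse, List.mem_map] at ha
      obtain ⟨b, hb, rfl⟩ := ha
      rw [inv_inv]
      exact (h1 b hb).symm) (by rw [← List.prod_inv_reverse, h2]; group)
    simpa using this
  have nonneg : ∀ x y, 0 ≤ wdist S x y := by
    intro x y
    obtain ⟨l, _, _, h3⟩ := wdist_word hgen x y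
    rw [h3]; positivity
  have self : ∀ x, wdist S x x = 0 := by
    intro x
    apply le_antisymm _ (nonneg _ _)
    simpa using wdist_le (S := S) (g := x) (k := x) (l := []) (by simp) (by simp)
  refine ⟨self, fun x y => le_antisymm (sle x y) (sle y x), tri, ?_⟩
  intro x y
  obtain ⟨l, h1, h2, h3⟩ := wdist_word hgen x y
  have up : ∀ i j, i ≤ j → j ≤ l.length →
      wdist S (x * (l.take i).prod) (x * (l.take j).prod) ≤ (j : ℝ) - i := by
    intro i j hij hj
    have e : l.take j = l.take i ++ (l.take j).drop i := by
      conv_lhs => rw [← List.take_append_drop i (l.take j)]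
      rw [List.take_take, min_eq_left hij]
    have := wdist_le (S := S) (g := x * (l.take i).prod) (k := x * (l.take j).prod)
      (l := (l.take j).drop i) (by
        intro a ha
        exact h1 a (List.mem_of_mem_take (List.mem_of_mem_drop ha))) (by
        conv_rhs => rw [e, List.prod_append]
        group)
    rw [List.length_drop, List.length_take, min_eq_left hj] at this
    push_cast [hij] at this
    exact this
  have main : ∀ i j, i ≤ j → j ≤ l.length →
      wdist S (x * (l.take i).prod) (x * (l.take j).prod) = (j : ℝ) - i := by
    intro i j hij hj
    apply le_antisymm (up i j hij hj)
    have u1 := up 0 i (by omega) (by omega)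
    have u2 := up j l.length hj le_rfl
    have t1 := tri (x * (l.take 0).prod) (x * (l.take i).prod) (x * (l.take l.length).prod)
    have t2 := tri (x * (l.take i).prod) (x * (l.take j).prod) (x * (l.take l.length).prod)
    have e : wdist S (x * (l.take 0).prod) (x * (l.take l.length).prod) = l.length := by
      rw [List.take_length, h2, List.take_zero, List.prod_nil, mul_one, mul_inv_cancel_left, h3]
    push_cast at *
    linarith
  refine ⟨fun i => x * (l.take i).prod, l.length, ?_, by simp, by simp [h2]⟩
  intro i hi j hj
  rcases le_total i j with hij | hij
  · rw [main i j hij hj, abs_sub_comm, abs_of_nonneg]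
    have : (i : ℝ) ≤ j := by exact_mod_cast hij
    linarith
  · have := main j i hij hi
    rw [le_antisymm (sle _ _) (sle _ _)] at this
    rw [this, abs_of_nonneg]
    have : (j : ℝ) ≤ i := by exact_mod_cast hij
    linarith

lemma ball_finite (hfin : S.Finite) (hgen : Subgroup.closure S = ⊤) (r : ℝ) :
    {g : G | wdist S 1 g ≤ r}.Finite := by
  have hW : ∀ n : ℕ, {g : G | ∃ l : List G, (∀ x ∈ l, x ∈ S ∨ x⁻¹ ∈ S) ∧ l.prod = g ∧
      l.length = n}.Finite := by
    intro n
    induction n with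
    | zero =>
      apply (Set.finite_singleton (1 : G)).subset
      rintro g ⟨l, _, h2, h3⟩
      rw [List.length_eq_zero_iff] at h3
      subst h3
      simpa using h2.symm
    | succ n ih =>
      have hT : (S ∪ (fun x => x⁻¹) '' S).Finite := hfin.union (hfin.image _)
      apply (Set.Finite.image2 (fun a b => a * b) hT ih).subset
      rintro g ⟨l, h1, h2, h3⟩
      cases l with
      | nil => simp at h3
      | cons a l =>
        refine ⟨a, ?_, l.prod, ⟨l, fun x hx => h1 x (List.mem_cons_of_mem _ hx), rfl, by simpa using h3⟩,
          by simpa using h2⟩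
        rcases h1 a (by simp) with h | h
        · exact Or.inl h
        · exact Or.inr ⟨_, h, by simp⟩
  obtain ⟨N, hN⟩ := exists_nat_ge r
  apply (Set.Finite.biUnion (Set.finite_Iic N) (fun n _ => hW n)).subset
  intro g hg
  obtain ⟨l, h1, h2, h3⟩ := wdist_word hgen 1 g
  have hg' : wdist S 1 g ≤ r := hg
  simp only [Set.mem_iUnion]
  refine ⟨l.length, ?_, l, h1, by simpa using h2, rfl⟩
  rw [h3] at hg'
  exact_mod_cast hg'.trans hN

variable {H : Subgroup G}

lemma coset_qc (hqc : QCSubgroup S H) :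
    ∃ C ≥ (0 : ℝ), ∀ (g : G) (c : ℕ → G) (m : ℕ), DiscGeodD (wdist S) c m → c 0 ∈ cosetSet H g →
      c m ∈ cosetSet H g → ∀ i ≤ m, ∃ a ∈ cosetSet H g, wdist S (c i) a ≤ C := by
  obtain ⟨C, hC, h⟩ := hqc
  refine ⟨C + 1, by linarith, ?_⟩
  intro g c m hc h0 hm i hi
  have := h (fun i => g⁻¹ * c i) m (fun i hi j hj => by rw [wdist_left]; exact hc i hi j hj)
    h0 hm i hi
  obtain ⟨a, ha, hd⟩ := pdist_le (A := (H : Set G)) ⟨1, H.one_mem⟩ this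
  refine ⟨g * a, ?_, ?_⟩
  · simpa [cosetSet] using ha
  · rw [← wdist_left g⁻¹]
    simpa using hd

lemma join_near_coset (hgen : Subgroup.closure S = ⊤) (hh : HypD (wdist S))
    (hqc : QCSubgroup S H) : ∃ K ≥ (0 : ℝ), ∀ (g p : G), p ∈ cosetJoin S H g →
      ∃ a ∈ cosetSet H g, wdist S p a ≤ K := by
  obtain ⟨C, hC, hqc⟩ := coset_qc hqc
  have h := wdist_geo hgen
  obtain ⟨δ, hδ0, hδ⟩ := id hh
  refine ⟨4 * δ + 1 + C, by positivity, ?_⟩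
  rintro g p ⟨γ, hγ, ⟨⟨ξ, ⟨s, hsA, hs⟩, hγp⟩, ⟨η, ⟨t, htA, ht⟩, hγm⟩⟩, ⟨i, rfl⟩⟩
  obtain ⟨N, hN⟩ := conv_rel h hh hs hγp (2 * δ + 1 + wdist S 1 (γ i))
  obtain ⟨N', hN'⟩ := conv_rel h hh ht hγm (2 * δ + 1 + wdist S 1 (γ i))
  set n := max (max N N') i.natAbs with hn
  have e1 := hN N le_rfl n (by omega)
  have e2 := hN' N' le_rfl n (by omega)
  have b1 := gp_base h 1 (γ i) (s N) (γ n)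
  have b2 := gp_base h 1 (γ i) (t N') (γ (-n))
  have g0 : gpD (wdist S) (γ i) (γ n) (γ (-n)) = 0 := by
    unfold gpD
    rw [hγ, hγ, hγ]
    have i1 : (i : ℝ) ≤ n := by exact_mod_cast (by omega : i ≤ n)
    have i2 : -(n : ℝ) ≤ i := by exact_mod_cast (by omega : -(n : ℤ) ≤ i)
    have n0 : (0 : ℝ) ≤ n := by positivity
    push_cast
    rw [abs_of_nonpos (by linarith), abs_of_nonneg (by linarith), abs_of_nonneg (by linarith)]
    ring
  have gst : gpD (wdist S) (γ i) (s N) (t N') ≤ 2 * δ := by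
    rw [gp_symm h (γ i)] at b1
    rcases hyp_or hδ (γ i) (γ n) (s N) (γ (-n)) with h1 | h1
    · linarith
    · rcases hyp_or hδ (γ i) (s N) (t N') (γ (-n)) with h2 | h2 <;> linarith
  obtain ⟨c, m, hc, hc0, hcm⟩ := h.geod (s N) (t N')
  obtain ⟨j, hj, hd⟩ := near_geod h hδ hc (γ i)
  rw [hc0, hcm] at hd
  obtain ⟨a, ha, hd'⟩ := hqc g c m hc (by rw [hc0]; exact hsA _) (by rw [hcm]; exact htA _) j hj
  exact ⟨a, ha, (h.tri _ (c j) _).trans (by linarith)⟩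

/-- An infinite quasiconvex subgroup has a bi-infinite geodesic nearby. -/
lemma exists_line (hfin : S.Finite) (hgen : Subgroup.closure S = ⊤) (hqc : QCSubgroup S H)
    (hinf : (H : Set G).Infinite) : ∃ C ≥ (0 : ℝ), ∃ γ : ℤ → G, DiscLineD (wdist S) γ ∧
      wdist S 1 (γ 0) ≤ C ∧ ∀ i, ∃ a ∈ H, wdist S (γ i) a ≤ C := by
  obtain ⟨C, hC, hqc⟩ := coset_qc hqc
  have h := wdist_geo hgen
  have h1 : ∀ n : ℕ, ∃ (c : ℕ → G) (m : ℕ) (k : G), DiscGeodD (wdist S) c m ∧ 2 * n ≤ m ∧ k ∈ H ∧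
      wdist S (c n) k ≤ C ∧ ∀ i ≤ m, ∃ a ∈ H, wdist S (c i) a ≤ C := by
    intro n
    obtain ⟨x, hx, hx'⟩ := hinf.exists_notMem_finite (ball_finite hfin hgen (2 * n))
    obtain ⟨c, m, hc, hc0, hcm⟩ := h.geod 1 x
    have hx2 : 2 * (n : ℝ) < wdist S 1 x := by simpa using hx'
    rw [← hc0, ← hcm, hc 0 (by omega) m le_rfl] at hx2
    simp only [Nat.cast_zero, zero_sub, abs_neg, Nat.abs_cast] at hx2
    have hm : 2 * n ≤ m := by exact_mod_cast hx2.le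
    have hq : ∀ i ≤ m, ∃ a ∈ H, wdist S (c i) a ≤ C := by
      intro i hi
      obtain ⟨a, ha, hd⟩ := hqc 1 c m hc (by simp [cosetSet, hc0, H.one_mem])
        (by simpa [cosetSet, hcm] using hx) i hi
      exact ⟨a, by simpa [cosetSet] using ha, hd⟩
    obtain ⟨k, hk, hkd⟩ := hq n (by omega)
    exact ⟨c, m, k, hc, hm, hk, hkd, hq⟩
  choose c m k hc hm hk hkd hq using h1
  let U : Ultrafilter ℕ := Filter.hyperfilter ℕ
  have hU : ∀ N : ℕ, ∀ᶠ n in (U : Filter ℕ), N ≤ n := by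
    intro N
    have : (U : Filter ℕ) ≤ atTop := by
      rw [← Nat.cofinite_eq_atTop]; exact Filter.hyperfilter_le_cofinite
    exact this (Filter.eventually_ge_atTop N)
  let f : ℕ → ℤ → G := fun n i => (k n)⁻¹ * c n ((n : ℤ) + i).toNat
  have fd : ∀ n i j, i.natAbs ≤ n → j.natAbs ≤ n → wdist S (f n i) (f n j) = |(i : ℝ) - j| := by
    intro n i j hi hj
    have := hm n
    simp only [f]
    rw [wdist_left, hc n _ (by omega) _ (by omega)]
    have e1 : ((((n : ℤ) + i).toNat : ℕ) : ℝ) = n + i := by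
      have : ((((n : ℤ) + i).toNat : ℕ) : ℤ) = n + i := Int.toNat_of_nonneg (by omega)
      exact_mod_cast this
    have e2 : ((((n : ℤ) + j).toNat : ℕ) : ℝ) = n + j := by
      have : ((((n : ℤ) + j).toNat : ℕ) : ℤ) = n + j := Int.toNat_of_nonneg (by omega)
      exact_mod_cast this
    rw [e1, e2]
    congr 1
    ring
  have f0 : ∀ n, wdist S 1 (f n 0) ≤ C := by
    intro n
    simp only [f]
    rw [← wdist_left (k n), h.symm]
    simpa using hkd n
  have fH : ∀ n i, i.natAbs ≤ n → ∃ a ∈ H, wdist S (f n i) a ≤ C := by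
    intro n i hi
    have := hm n
    obtain ⟨a, ha, hd⟩ := hq n ((n : ℤ) + i).toNat (by omega)
    refine ⟨(k n)⁻¹ * a, H.mul_mem (H.inv_mem (hk n)) ha, ?_⟩
    simp only [f]
    rw [wdist_left]
    exact hd
  have hv : ∀ i : ℤ, ∃ v, ∀ᶠ n in (U : Filter ℕ), f n i = v := by
    intro i
    have hb := ball_finite hfin hgen (C + |(0 : ℝ) - i|)
    have : ∀ᶠ n in (U : Filter ℕ), f n i ∈ {g : G | wdist S 1 g ≤ C + |(0 : ℝ) - i|} := by
      filter_upwards [hU i.natAbs] with n hn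
      have e := fd n 0 i (by simp) hn
      have t := h.tri 1 (f n 0) (f n i)
      rw [e] at t
      have := f0 n
      simp only [Int.cast_zero] at *
      change wdist S 1 _ ≤ _
      linarith
    have h2 : (⋃ v ∈ {g : G | wdist S 1 g ≤ C + |(0 : ℝ) - i|}, {n | f n i = v}) ∈ U := by
      filter_upwards [this] with n hn
      simp only [Set.mem_iUnion]
      exact ⟨f n i, hn, rfl⟩
    rw [Ultrafilter.finite_biUnion_mem_iff hb] at h2
    obtain ⟨v, _, hv⟩ := h2
    exact ⟨v, hv⟩
  choose γ hγ using hv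
  refine ⟨C, hC, γ, ?_, ?_, ?_⟩
  · intro i j
    obtain ⟨n, h1, h2, h3, h4⟩ :=
      ((hγ i).and ((hγ j).and ((hU i.natAbs).and (hU j.natAbs)))).exists
    rw [← h1, ← h2]
    exact fd n i j h3 h4
  · obtain ⟨n, h1⟩ := (hγ 0).exists
    rw [← h1]
    exact f0 n
  · intro i
    obtain ⟨n, h1, h2⟩ := ((hγ i).and (hU i.natAbs)).exists
    rw [← h1]
    exact fH n i h2

lemma coset_near_join (hfin : S.Finite) (hgen : Subgroup.closure S = ⊤) (hqc : QCSubgroup S H)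
    (hinf : (H : Set G).Infinite) : ∃ K ≥ (0 : ℝ), ∀ (g a : G), a ∈ cosetSet H g →
      ∃ p ∈ cosetJoin S H g, wdist S a p ≤ K := by
  obtain ⟨C, hC, γ, hγ, h0, hH⟩ := exists_line hfin hgen hqc hinf
  have h := wdist_geo hgen
  refine ⟨C, hC, ?_⟩
  intro g a ha
  have ha' : g⁻¹ * a ∈ H := ha
  choose b hbH hb using hH
  have hmem : ∀ i, a * b i ∈ cosetSet H g := by
    intro i
    change g⁻¹ * (a * b i) ∈ H
    rw [← mul_assoc]
    exact H.mul_mem ha' (hbH i)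
  have hγ' : DiscLineD (wdist S) (fun i => a * γ i) := fun i j => by rw [wdist_left]; exact hγ i j
  have r1 : GromovSeqD (wdist S) 1 (fun n : ℕ => a * γ (n : ℤ)) :=
    ray_gromov h 1 _ (fun i j => by simpa using hγ' i j)
  have r2 : GromovSeqD (wdist S) 1 (fun n : ℕ => a * γ (-(n : ℤ))) :=
    ray_gromov h 1 _ (fun i j => by
      have := hγ' (-(i : ℤ)) (-(j : ℤ))
      push_cast at this
      rw [this, abs_sub_comm]
      congr 1
      ring)
  refine ⟨a * γ 0, ⟨fun i => a * γ i, hγ', ⟨⟨Quot.mk _ ⟨_, r1⟩, ?_, ⟨r1, rfl⟩⟩,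
    ⟨Quot.mk _ ⟨_, r2⟩, ?_, ⟨r2, rfl⟩⟩⟩, ⟨0, rfl⟩⟩, ?_⟩
  · refine ⟨fun n : ℕ => a * b n, fun n => hmem _, conv_perturb (K := C) h ⟨r1, rfl⟩ ?_⟩
    intro n
    rw [wdist_left]
    exact hb _
  · refine ⟨fun n : ℕ => a * b (-n), fun n => hmem _, conv_perturb (K := C) h ⟨r2, rfl⟩ ?_⟩
    intro n
    rw [wdist_left]
    exact hb _
  · have := wdist_left (S := S) a 1 (γ 0)
    rw [mul_one] at this
    rw [this]
    exact h0

/-- Lemma K: many cosets near a point cannot all be close to a far away coset. -/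
lemma many_cosets (hfin : S.Finite) (hgen : Subgroup.closure S = ⊤) (hh : HypD (wdist S))
    (hqc : QCSubgroup S H) : ∃ N : ℕ, ∀ g : Fin N → G, (∀ i j, (g i)⁻¹ * g j ∈ H → i = j) →
      ∀ D : ℝ, 0 ≤ D → ∃ M : ℝ, 0 ≤ M ∧ ∀ x r : G,
        (∀ j, ∃ a ∈ cosetSet H (x * g j), ∃ b ∈ cosetSet H r, wdist S a b ≤ D) →
        ∃ b ∈ cosetSet H r, wdist S x b ≤ M := by
  obtain ⟨C, hC, hqc⟩ := coset_qc hqc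
  have h := wdist_geo hgen
  obtain ⟨δ, hδ0, hδ⟩ := id hh
  have hball := ball_finite hfin hgen (4 * δ + 1 + C)
  refine ⟨hball.toFinset.card + 1, ?_⟩
  intro g hg D hD
  obtain ⟨R, hR⟩ : ∃ R : ℝ, ∀ j, wdist S 1 (g j) ≤ R := by
    refine ⟨∑ j, wdist S 1 (g j), fun j => ?_⟩
    exact Finset.single_le_sum (f := fun j => wdist S 1 (g j)) (fun i _ => h.nonneg _ _)
      (Finset.mem_univ j)
  have hR0 : 0 ≤ R := (h.nonneg _ _).trans (hR 0)
  obtain ⟨T, hT⟩ := exists_nat_gt (R + 2 * δ)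
  have hT0 : (0 : ℝ) ≤ T := by positivity
  refine ⟨T + (2 * δ + C + 2) + D + δ + 1, by positivity, ?_⟩
  intro x r hx
  by_contra hcon
  push Not at hcon
  -- an approximate nearest point
  obtain ⟨p, hp, hpn⟩ := pdist_le (d := wdist S) (x := x) (A := cosetSet H r)
    ⟨r, by simp [cosetSet, H.one_mem]⟩ le_rfl
  have hpn' : ∀ u ∈ cosetSet H r, wdist S x p ≤ wdist S x u + 1 := fun u hu =>
    hpn.trans (by linarith [le_pdist h (x := x) hu])
  have hpM := hcon p hp
  have hgp : ∀ b ∈ cosetSet H r, gpD (wdist S) p x b ≤ 2 * δ + C + 2 := by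
    intro b hb
    obtain ⟨c, m, hc, hc0, hcm⟩ := h.geod p b
    have t1 : gpD (wdist S) p x b ≤ m := by
      have e3 := hc 0 (Nat.zero_le _) m le_rfl
      rw [abs_of_nonpos (by simp), hc0, hcm] at e3
      unfold gpD
      have := h.tri p b x
      rw [h.symm b x] at this
      push_cast at e3
      linarith
    have t0 : 0 ≤ gpD (wdist S) p x b := by
      unfold gpD
      have := h.tri x p b
      rw [h.symm x p] at this
      linarith
    set i := ⌊gpD (wdist S) p x b⌋₊ with hidef
    have hi : i ≤ m := Nat.floor_le_of_le t1
    have f1 : (i : ℝ) ≤ gpD (wdist S) p x b := Nat.floor_le t0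
    have f2 : gpD (wdist S) p x b < i + 1 := Nat.lt_floor_add_one _
    obtain ⟨a, ha, had⟩ := hqc r c m hc (by rw [hc0]; exact hp) (by rw [hcm]; exact hb) i hi
    have n1 := hpn' a ha
    have n2 := h.tri x (c i) a
    have e1 := hc 0 (Nat.zero_le _) i hi
    have e2 := hc m le_rfl i hi
    have e3 := hc 0 (Nat.zero_le _) m le_rfl
    have hi' : (i : ℝ) ≤ m := by exact_mod_cast hi
    have hi0 : (0 : ℝ) ≤ i := Nat.cast_nonneg _
    rw [abs_of_nonpos (by simp), hc0] at e1
    rw [abs_of_nonneg (by linarith), hcm] at e2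
    rw [abs_of_nonpos (by simp), hc0, hcm] at e3
    push_cast at e1 e2 e3
    have gb : gpD (wdist S) p b (c i) = i := by unfold gpD; linarith
    have s1 := h.symm p x
    have ge : gpD (wdist S) p x (c i) = (wdist S p x + wdist S p (c i) - wdist S x (c i)) / 2 := rfl
    rcases hyp_or hδ p x b (c i) with h3 | h3 <;> linarith
  obtain ⟨e, l, he, he0, hel⟩ := h.geod x p
  have el : wdist S x p = l := by
    have := he 0 (Nat.zero_le _) l le_rfl
    rw [abs_of_nonpos (by simp), he0, hel] at this
    push_cast at this
    linarith
  have hTl : T ≤ l := by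
    have : (T : ℝ) ≤ l := by linarith
    exact_mod_cast this
  have hTl' : (T : ℝ) ≤ l := by exact_mod_cast hTl
  set y := e T with hy
  have exy : wdist S y x = T := by
    have := he T hTl 0 (Nat.zero_le _)
    rw [abs_of_nonneg (by simp), he0] at this
    simpa using this
  have eyp : wdist S y p = l - T := by
    have := he T hTl l le_rfl
    rw [abs_of_nonpos (by linarith), hel] at this
    linarith
  have hu : ∀ j, ∃ u ∈ cosetSet H (x * g j), wdist S y u ≤ 4 * δ + 1 + C := by
    intro j
    obtain ⟨a, ha, b, hb, hab⟩ := hx j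
    have hx' : x * g j ∈ cosetSet H (x * g j) := by simp [cosetSet, H.one_mem]
    have exx : wdist S x (x * g j) ≤ R := by
      have := wdist_left (S := S) x 1 (g j)
      rw [mul_one] at this
      rw [this]; exact hR j
    have g1 := hgp b hb
    have g2 : (l : ℝ) - T - (2 * δ + C + 2) ≤ gpD (wdist S) y p b := by
      have t1 := h.tri x y b
      rw [h.symm x y] at t1
      unfold gpD at *
      rw [h.symm p x] at g1
      linarith
    have g3 : (l : ℝ) - T - (2 * δ + C + 2) - D ≤ gpD (wdist S) y a p := by
      have := gp_move h y p b a
      rw [h.symm b a, gp_symm h y p a] at this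
      linarith
    have g4 : gpD (wdist S) y x p = 0 := by
      unfold gpD
      rw [exy, eyp, el]; ring
    have g5 : gpD (wdist S) y x a ≤ δ := by
      rcases hyp_or hδ y x a p with h3 | h3 <;> linarith
    have g6 := gp_ge_left h y x (x * g j)
    have g7 : gpD (wdist S) y (x * g j) a ≤ 2 * δ := by
      rcases hyp_or hδ y x (x * g j) a with h3 | h3 <;> linarith
    obtain ⟨c, m, hc, hc0, hcm⟩ := h.geod (x * g j) a
    obtain ⟨i, hi, hd⟩ := near_geod h hδ hc y
    rw [hc0, hcm] at hd
    obtain ⟨u, hu, hd'⟩ := hqc _ c m hc (by rw [hc0]; exact hx') (by rw [hcm]; exact ha) i hi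
    exact ⟨u, hu, (h.tri _ (c i) _).trans (by linarith)⟩
  choose u huH hud using hu
  obtain ⟨j, -, j', -, hne, heq⟩ := Finset.exists_ne_map_eq_of_card_lt_of_maps_to
    (s := (Finset.univ : Finset (Fin (hball.toFinset.card + 1)))) (t := hball.toFinset)
    (f := fun j => y⁻¹ * u j) (by simp) (by
      intro j _
      simp only [Finset.mem_coe, Set.Finite.mem_toFinset, Set.mem_ofPred_eq]
      rw [← wdist_left y]
      simpa using hud j)
  apply hne
  apply hg
  have heq' : u j = u j' := mul_left_cancel heq
  have m1 : (x * g j)⁻¹ * u j ∈ H := huH j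
  have m2 : (x * g j')⁻¹ * u j' ∈ H := huH j'
  rw [← heq'] at m2
  have := H.mul_mem m1 (H.inv_mem m2)
  convert this using 1
  group

lemma not_cobounded (hfin : S.Finite) (hgen : Subgroup.closure S = ⊤) (hinf : Infinite (G ⧸ H))
    (g : G) (M : ℝ) : ¬ ∀ x, ∃ b ∈ cosetSet H g, wdist S x b ≤ M := by
  intro hall
  have hb := ball_finite hfin hgen M
  have : (Set.univ : Set (G ⧸ H)).Finite := by
    apply (hb.image (fun z => (QuotientGroup.mk z : G ⧸ H))).subset
    intro Z _
    obtain ⟨z, rfl⟩ := QuotientGroup.mk_surjective Z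
    obtain ⟨b, hbH, hd⟩ := hall (g * z⁻¹)
    refine ⟨(g * z⁻¹)⁻¹ * b, ?_, ?_⟩
    · change wdist S 1 _ ≤ M
      rw [← wdist_left (g * z⁻¹), mul_one, mul_inv_cancel_left]
      exact hd
    · rw [eq_comm]
      apply QuotientGroup.eq.2
      have : g⁻¹ * b ∈ H := hbH
      convert this using 1
      group
  exact Set.infinite_univ this

lemma limit_empty (hgen : Subgroup.closure S = ⊤) (hH : (H : Set G).Finite) (g : G) :
    cosetLimitSet S H g = ∅ := by
  rw [Set.eq_empty_iff_forall_notMem]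
  rintro ξ ⟨s, hs, ⟨hgs, -⟩⟩
  have h := wdist_geo hgen
  have hc : (cosetSet H g).Finite := by
    apply (hH.image (fun x => g * x)).subset
    intro x hx
    exact ⟨g⁻¹ * x, hx, by simp⟩
  obtain ⟨B, hB⟩ := (hc.image (fun x => wdist S 1 x)).bddAbove
  obtain ⟨N, hN⟩ := (tend_iff _).1 hgs (B + 1)
  have h1 := hN N le_rfl N le_rfl
  have h2 := hB ⟨s N, hs N, rfl⟩
  simp only [gpD, h.self] at h1 h2
  linarith

lemma join_empty {g : G} (hL : cosetLimitSet S H g = ∅) : cosetJoin S H g = ∅ := by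
  rw [Set.eq_empty_iff_forall_notMem]
  rintro p ⟨γ, _, ⟨⟨ξ, hξ, _⟩, _⟩, _⟩
  rw [hL] at hξ
  exact hξ

lemma exists_distinct (hinf : Infinite (G ⧸ H)) (N : ℕ) :
    ∃ g : Fin N → G, ∀ i j, (g i)⁻¹ * g j ∈ H → i = j := by
  let e := Infinite.natEmbedding (G ⧸ H)
  refine ⟨fun i => (e i).out, fun i j hij => ?_⟩
  have := QuotientGroup.eq.2 hij
  rw [QuotientGroup.out_eq', QuotientGroup.out_eq'] at this
  exact Fin.ext (e.injective this)

lemma coset_eq {g k : G} (h : g⁻¹ * k ∈ H) : cosetSet H g = cosetSet H k := by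
  ext x
  have e1 : g⁻¹ * x = (g⁻¹ * k) * (k⁻¹ * x) := by group
  change g⁻¹ * x ∈ H ↔ k⁻¹ * x ∈ H
  rw [e1, H.mul_mem_cancel_left h]

end WordMetric

lemma boundary_inj {α β : Type*} {d : α → α → ℝ} {d' : β → β → ℝ} (h : GeoD d) (hh : HypD d)
    (h' : GeoD d') (hh' : HypD d') {q : α → β} (hq : QIMapD d d' q) {w : α} {w' : β}
    (Q : BdryD d w → BdryD d' w')
    (hQ : ∀ (s : ℕ → α) (ξ : BdryD d w), ConvTo d w s ξ → ConvTo d' w' (fun n => q (s n)) (Q ξ)) :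
    Function.Injective Q := by
  intro ξ η e
  obtain ⟨⟨s, hs⟩, rfl⟩ := Quot.exists_rep ξ
  obtain ⟨⟨t, ht⟩, rfl⟩ := Quot.exists_rep η
  have c1 := hQ s _ ⟨hs, rfl⟩
  have c2 := hQ t _ ⟨ht, rfl⟩
  rw [← e] at c2
  obtain ⟨_, hee⟩ := conv_of_rel ⟨hs, rfl⟩ ht (qi_pull h hh h' hq w w' s t (conv_rel h' hh' c1 c2))
  exact hee.symm

/-- **Lemma (intpattn).** With `G₁, G₂` hyperbolic groups, `H₁, H₂` quasiconvex
subgroups of infinite index, `ℒᵢ` the collections of translates of the limit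
sets and `𝒥ᵢ` the corresponding joins: let `φ : 𝒥₁ → 𝒥₂` be a uniformly proper
bijection, `q : Γ₁ → Γ₂` a quasi-isometry pairing `𝒥₁` with `𝒥₂` as `φ` does,
and `∂q` its boundary extension.  Then for finitely many members
`L₁¹, …, L_k¹` of `ℒ₁` the following are equivalent: (1) `⋂ᵢ Lᵢ¹ = ∅`;
(2) `⋂ᵢ ∂q(Lᵢ¹) = ∅`; (3) `⋂ᵢ φ(Lᵢ¹) = ∅` (where `φ(Lᵢ¹)` is the limit set of
`φ(J(Lᵢ¹))`). -/
theorem boundary_extension_preserves_intersection_patterns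
    {G₁ : Type*} [Group G₁] {G₂ : Type*} [Group G₂]
    (S₁ : Set G₁) (S₂ : Set G₂) (hS₁fin : S₁.Finite) (hS₂fin : S₂.Finite)
    (hS₁gen : Subgroup.closure S₁ = ⊤) (hS₂gen : Subgroup.closure S₂ = ⊤)
    (hhyp₁ : HypD (wdist S₁)) (hhyp₂ : HypD (wdist S₂))
    (H₁ : Subgroup G₁) (H₂ : Subgroup G₂)
    (hqc₁ : QCSubgroup S₁ H₁) (hqc₂ : QCSubgroup S₂ H₂)
    (hinf₁ : Infinite (G₁ ⧸ H₁)) (hinf₂ : Infinite (G₂ ⧸ H₂))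
    (R₁ : Set G₁) (R₂ : Set G₂) (hR₁ : IsCosetReps H₁ R₁) (hR₂ : IsCosetReps H₂ R₂)
    (φ : R₁ → R₂) (hφ : Function.Bijective φ)
    (hprop : UProperD (wdist S₁) (wdist S₂)
      (fun r : R₁ => cosetJoin S₁ H₁ (r : G₁))
      (fun r : R₂ => cosetJoin S₂ H₂ (r : G₂)) φ)
    (q : G₁ → G₂) (hq : QIMapD (wdist S₁) (wdist S₂) q)
    (hpair : PairsAsD (wdist S₁) (wdist S₂) q
      (fun r : R₁ => cosetJoin S₁ H₁ (r : G₁))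
      (fun r : R₂ => cosetJoin S₂ H₂ (r : G₂)) φ)
    (Q : BdryD (wdist S₁) (1 : G₁) → BdryD (wdist S₂) (1 : G₂))
    (hQ : ∀ (s : ℕ → G₁) (ξ : BdryD (wdist S₁) (1 : G₁)),
      ConvTo (wdist S₁) 1 s ξ → ConvTo (wdist S₂) 1 (fun n => q (s n)) (Q ξ)) :
    ∀ k : ℕ, 0 < k → ∀ σ : Fin k → R₁,
      ((⋂ a, cosetLimitSet S₁ H₁ ((σ a : G₁))) = ∅ ↔
        (⋂ a, Q '' cosetLimitSet S₁ H₁ ((σ a : G₁))) = ∅) ∧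
      ((⋂ a, cosetLimitSet S₁ H₁ ((σ a : G₁))) = ∅ ↔
        (⋂ a, cosetLimitSet S₂ H₂ ((φ (σ a) : G₂))) = ∅) := by
  intro k hk σ
  have h₁ := wdist_geo hS₁gen
  have h₂ := wdist_geo hS₂gen
  have hinj := boundary_inj h₁ hhyp₁ h₂ hhyp₂ hq Q hQ
  have : Nonempty (Fin k) := ⟨⟨0, hk⟩⟩
  constructor
  · rw [← hinj.injOn.image_iInter_eq, Set.image_eq_empty]
  -- some representative exists
  obtain ⟨ρ₀, ⟨hρ₀, -⟩, -⟩ := hR₁ 1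
  let r₀ : R₁ := ⟨ρ₀, hρ₀⟩
  have hself₁ : ∀ g : G₁, g ∈ cosetSet H₁ g := fun g => by simp [cosetSet, H₁.one_mem]
  have hself₂ : ∀ g : G₂, g ∈ cosetSet H₂ g := fun g => by simp [cosetSet, H₂.one_mem]
  obtain ⟨K₂, hK₂, hjc₂⟩ := join_near_coset hS₂gen hhyp₂ hqc₂
  obtain ⟨K₁, hK₁, hjc₁⟩ := join_near_coset hS₁gen hhyp₁ hqc₁
  by_cases hH₁ : (H₁ : Set G₁).Finite
  · -- `H₁` finite
    have L1 : ∀ g, cosetLimitSet S₁ H₁ g = ∅ := limit_empty hS₁gen hH₁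
    by_cases hH₂ : (H₂ : Set G₂).Finite
    · have L2 : ∀ g, cosetLimitSet S₂ H₂ g = ∅ := limit_empty hS₂gen hH₂
      simp only [L1, L2, Set.iInter_const]
    · exfalso
      obtain ⟨K, hK, hcj⟩ := coset_near_join hS₂fin hS₂gen hqc₂ hH₂
      obtain ⟨p₀, hp₀, -⟩ := hcj _ _ (hself₂ (φ r₀ : G₂))
      obtain ⟨f, hf⟩ := hpair
      obtain ⟨l, C, hl, hC, hqi, hsurj⟩ := hq
      apply not_cobounded hS₂fin hS₂gen hinf₂ (φ r₀ : G₂) (C + (f 0 + 1) + K₂)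
      intro x
      obtain ⟨z, hz⟩ := hsurj x
      have e := hf 0 z r₀ (by
        simp only [join_empty (L1 _)]
        simp [pdistD])
      obtain ⟨p, hp, hpd⟩ := pdist_le ⟨p₀, hp₀⟩ e
      obtain ⟨b, hb, hbd⟩ := hjc₂ _ _ hp
      refine ⟨b, hb, ?_⟩
      have t1 := h₂.tri x (q z) b
      have t2 := h₂.tri (q z) p b
      linarith
  -- `H₁` infinite
  obtain ⟨K, hK, hcj₁⟩ := coset_near_join hS₁fin hS₁gen hqc₁ hH₁
  obtain ⟨N, hN⟩ := many_cosets hS₁fin hS₁gen hhyp₁ hqc₁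
  obtain ⟨g, hg⟩ := exists_distinct hinf₁ N
  have hne₁ : ∀ r : G₁, (cosetJoin S₁ H₁ r).Nonempty := fun r => by
    obtain ⟨p, hp, -⟩ := hcj₁ _ _ (hself₁ r)
    exact ⟨p, hp⟩
  have hrep : ∀ x : G₁, ∃ r : R₁, cosetSet H₁ (r : G₁) = cosetSet H₁ x := by
    intro x
    obtain ⟨r, ⟨hr, hr'⟩, -⟩ := hR₁ x
    exact ⟨⟨r, hr⟩, (coset_eq hr').symm⟩
  have hclose : ∀ (r r' : R₁) (n : ℕ),
      setDistD (wdist S₁) (cosetJoin S₁ H₁ (r : G₁)) (cosetJoin S₁ H₁ (r' : G₁)) ≤ n →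
      ∃ a ∈ cosetSet H₁ (r : G₁), ∃ b ∈ cosetSet H₁ (r' : G₁),
        wdist S₁ a b ≤ K₁ + (n + 1) + K₁ := by
    intro r r' n hn
    obtain ⟨a, ha, b, hb, hab⟩ := setDist_le (hne₁ _) (hne₁ _) hn
    obtain ⟨a', ha', had⟩ := hjc₁ _ _ ha
    obtain ⟨b', hb', hbd⟩ := hjc₁ _ _ hb
    refine ⟨a', ha', b', hb', ?_⟩
    have t1 := h₁.tri a' a b'
    have t2 := h₁.tri a b b'
    rw [h₁.symm a' a] at t1
    linarith
  obtain ⟨f, hf⟩ := hprop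
  by_cases hH₂ : (H₂ : Set G₂).Finite
  · -- `H₂` finite
    exfalso
    have L2 : ∀ g, cosetLimitSet S₂ H₂ g = ∅ := limit_empty hS₂gen hH₂
    obtain ⟨M, hM0, hM⟩ := hN g hg (K₁ + (f 0 + 1) + K₁) (by positivity)
    apply not_cobounded hS₁fin hS₁gen hinf₁ (r₀ : G₁) M
    intro x
    apply hM
    intro j
    obtain ⟨r, hr⟩ := hrep (x * g j)
    rw [← hr]
    apply hclose
    apply (hf 0 r r₀).2
    simp only [join_empty (L2 _)]
    simp [setDistD]
  -- both infinite
  obtain ⟨K', hK', hcj₂⟩ := coset_near_join hS₂fin hS₂gen hqc₂ hH₂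
  have hne₂ : ∀ r : G₂, (cosetJoin S₂ H₂ r).Nonempty := fun r => by
    obtain ⟨p, hp, -⟩ := hcj₂ _ _ (hself₂ r)
    exact ⟨p, hp⟩
  obtain ⟨f', hf'⟩ := hpair
  obtain ⟨l, C, hl, hC, hqi, hsurj⟩ := id hq
  obtain ⟨R, hR⟩ : ∃ R : ℝ, ∀ j, wdist S₁ 1 (g j) ≤ R := by
    refine ⟨∑ j, wdist S₁ 1 (g j), fun j => ?_⟩
    exact Finset.single_le_sum (f := fun j => wdist S₁ 1 (g j)) (fun i _ => h₁.nonneg _ _)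
      (Finset.mem_univ j)
  -- the images under `Q`
  have hsub : ∀ r : R₁, ∀ ξ ∈ cosetLimitSet S₁ H₁ (r : G₁),
      Q ξ ∈ cosetLimitSet S₂ H₂ (φ r : G₂) := by
    rintro r ξ ⟨s, hs, hc⟩
    obtain ⟨n, hn⟩ := exists_nat_ge K
    have hx : ∀ m, ∃ b ∈ cosetSet H₂ (φ r : G₂), wdist S₂ (q (s m)) b ≤ f' n + 1 + K₂ := by
      intro m
      obtain ⟨p, hp, hpd⟩ := hcj₁ _ _ (hs m)
      have e := hf' n (s m) r ((le_pdist h₁ hp).trans (hpd.trans hn))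
      obtain ⟨p', hp', hpd'⟩ := pdist_le (hne₂ _) e
      obtain ⟨b, hb, hbd⟩ := hjc₂ _ _ hp'
      exact ⟨b, hb, (h₂.tri _ p' _).trans (by linarith)⟩
    choose b hb hbd using hx
    exact ⟨b, hb, conv_perturb h₂ (hQ s ξ hc) hbd⟩
  obtain ⟨n₀, hn₀⟩ := exists_nat_ge (R + K)
  obtain ⟨n₁, hn₁⟩ := exists_nat_ge ((f' n₀ : ℝ) + 1 + (C + K'))
  obtain ⟨M, hM0, hM⟩ := hN g hg (K₁ + (f n₁ + 1) + K₁) (by positivity)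
  have hcov : ∀ (r : R₁), ∀ z ∈ cosetSet H₂ (φ r : G₂),
      ∃ b ∈ cosetSet H₁ (r : G₁), wdist S₂ z (q b) ≤ C + (l * M + C) := by
    intro r z hz
    obtain ⟨x, hx⟩ := hsurj z
    obtain ⟨b, hb, hbd⟩ := hM x (r : G₁) (by
      intro j
      obtain ⟨r', hr'⟩ := hrep (x * g j)
      rw [← hr']
      apply hclose
      apply (hf n₁ r' r).2
      have hxg : x * g j ∈ cosetSet H₁ (r' : G₁) := by rw [hr']; exact hself₁ _
      obtain ⟨p, hp, hpd⟩ := hcj₁ _ _ hxg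
      have exx : wdist S₁ x (x * g j) ≤ R := by
        have := wdist_left (S := S₁) x 1 (g j)
        rw [mul_one] at this
        rw [this]; exact hR j
      have t1 := h₁.tri x (x * g j) p
      have e := hf' n₀ x r' ((le_pdist h₁ hp).trans (by linarith))
      obtain ⟨p', hp', hpd'⟩ := pdist_le (hne₂ _) e
      obtain ⟨p'', hp'', hpd''⟩ := hcj₂ _ _ hz
      refine (le_setDist h₂ hp' hp'').trans ?_
      have t2 := h₂.tri p' (q x) p''
      have t3 := h₂.tri (q x) z p''
      rw [h₂.symm p' (q x)] at t2
      rw [h₂.symm (q x) z] at t3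
      linarith)
    refine ⟨b, hb, ?_⟩
    have t1 := h₂.tri z (q x) (q b)
    have q1 := (hqi x b).1
    have : l * wdist S₁ x b ≤ l * M := mul_le_mul_of_nonneg_left hbd (by linarith)
    linarith
  have hsup : ∀ r : R₁, ∀ η ∈ cosetLimitSet S₂ H₂ (φ r : G₂),
      ∃ ξ ∈ cosetLimitSet S₁ H₁ (r : G₁), Q ξ = η := by
    rintro r η ⟨s, hs, hc⟩
    have hx := fun m => hcov r (s m) (hs m)
    choose u hu hud using hx
    have hcu : ConvTo (wdist S₂) 1 (fun n => q (u n)) η := conv_perturb h₂ hc hud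
    have hgu : GromovSeqD (wdist S₁) 1 u :=
      (tend_iff _).2 (qi_pull h₁ hhyp₁ h₂ hq 1 1 u u ((tend_iff _).1 hcu.1))
    refine ⟨Quot.mk _ ⟨u, hgu⟩, ⟨u, hu, hgu, rfl⟩, ?_⟩
    obtain ⟨_, e1⟩ := hQ u (Quot.mk _ ⟨u, hgu⟩) ⟨hgu, rfl⟩
    obtain ⟨_, e2⟩ := hcu
    rw [← e1, ← e2]
  have himg : ∀ r : R₁, cosetLimitSet S₂ H₂ (φ r : G₂) = Q '' cosetLimitSet S₁ H₁ (r : G₁) := by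
    intro r
    ext η
    constructor
    · intro h
      obtain ⟨ξ, h1, h2⟩ := hsup r η h
      exact ⟨ξ, h1, h2⟩
    · rintro ⟨ξ, h1, rfl⟩
      exact hsub r ξ h1
  simp only [himg]
  rw [← hinj.injOn.image_iInter_eq, Set.image_eq_empty]

end RelRig
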